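/- arXiv:2501.09266 — 10 statements merged into one kernel-verified Lean document; each statement's English description precedes it below -/
import Mathlib

section
/- Let R₁ ∈ (0,1) and δ > 0. For R₂ ∈ (R₁, 1], define h_{R₁,R₂}(ρ) := (π / log(R₂/R₁)) · 1/(sinh ρ · sin(π·(log R₂ − log tanh(ρ/2)) / log(R₂/R₁))). Then there exists ρ* > 0 such that for every ρ₀ ≥ ρ*, there exists R(ρ₀) with tanh((ρ₀+1)/2) < R(ρ₀) < 1 such that for every R₂ ∈ [R(ρ₀), 1], the following hold for all ρ ∈ [ρ₀, ρ₀+1]: |h_{R₁,R₂}(ρ) − 1| ≤ δ, |h_{R₁,R₂}'(ρ)| ≤ δ, and |h_{R₁,R₂}''(ρ)| ≤ δ. -/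
/-- The metric density of the Poincaré metric of the annulus `{R₁ < |z| < R₂}`
in hyperbolic polar coordinates `ρ = 2 * artanh |z|`. -/
noncomputable def hR (R₁ R₂ : ℝ) : ℝ → ℝ :=
  fun ρ => (Real.pi / Real.log (R₂ / R₁)) *
    (1 / (Real.sinh ρ *
      Real.sin (Real.pi * (Real.log R₂ - Real.log (Real.tanh (ρ / 2))) / Real.log (R₂ / R₁))))

open Filter Topology

/-- The reciprocal of the density `hR`. -/
noncomputable def hRInv (R₁ R₂ : ℝ) : ℝ → ℝ :=
  fun ρ => Real.sinh ρ *
    Real.sin (Real.pi / Real.log (R₂ / R₁) * (Real.log R₂ - Real.log (Real.tanh (ρ / 2)))) /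
      (Real.pi / Real.log (R₂ / R₁))

/-- The first derivative of `hRInv`. -/
noncomputable def hRInvDeriv (R₁ R₂ : ℝ) : ℝ → ℝ :=
  fun ρ => Real.cosh ρ / Real.sinh ρ * hRInv R₁ R₂ ρ -
    Real.cos (Real.pi / Real.log (R₂ / R₁) * (Real.log R₂ - Real.log (Real.tanh (ρ / 2))))

theorem hR_eq_inv (R₁ R₂ : ℝ) : hR R₁ R₂ = fun ρ => (hRInv R₁ R₂ ρ)⁻¹ := by
  funext ρ
  simp only [hR, hRInv]
  rw [inv_div, mul_one_div, mul_div_right_comm Real.pi]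

theorem hasDerivAt_log_tanh_half {ρ : ℝ} (hρ : 0 < ρ) :
    HasDerivAt (fun ρ => Real.log (Real.tanh (ρ / 2))) (1 / Real.sinh ρ) ρ := by
  have hs : 0 < Real.sinh (ρ / 2) := Real.sinh_pos_iff.2 (by linarith)
  have hc : 0 < Real.cosh (ρ / 2) := Real.cosh_pos _
  have hd : HasDerivAt (fun ρ : ℝ => ρ / 2) (1 / 2) ρ := (hasDerivAt_id ρ).div_const 2
  have h := (hd.sinh.fun_div hd.cosh hc.ne').log (div_pos hs hc).ne'
  have hsinh : Real.sinh ρ = 2 * Real.sinh (ρ / 2) * Real.cosh (ρ / 2) := by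
    rw [← Real.sinh_two_mul]; congr 1; ring
  have hsq := Real.cosh_sq (ρ / 2)
  simp only [Real.tanh_eq_sinh_div_cosh]
  refine h.congr_deriv ?_
  rw [hsinh]
  field_simp
  linarith

theorem hasDerivAt_angle (c a : ℝ) {ρ : ℝ} (hρ : 0 < ρ) :
    HasDerivAt (fun ρ => c * (a - Real.log (Real.tanh (ρ / 2)))) (-(c / Real.sinh ρ)) ρ := by
  refine (((hasDerivAt_log_tanh_half hρ).const_sub a).const_mul c).congr_deriv ?_
  ring

theorem hasDerivAt_hRInv {R₁ R₂ ρ : ℝ} (hc : Real.pi / Real.log (R₂ / R₁) ≠ 0) (hρ : 0 < ρ) :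
    HasDerivAt (hRInv R₁ R₂) (hRInvDeriv R₁ R₂ ρ) ρ := by
  have hs : Real.sinh ρ ≠ 0 := (Real.sinh_pos_iff.2 hρ).ne'
  have h := ((Real.hasDerivAt_sinh ρ).fun_mul
    (hasDerivAt_angle (Real.pi / Real.log (R₂ / R₁)) (Real.log R₂) hρ).sin).div_const
      (Real.pi / Real.log (R₂ / R₁))
  unfold hRInvDeriv hRInv
  generalize Real.pi / Real.log (R₂ / R₁) = c at *
  refine h.congr_deriv ?_
  field_simp
  ring

theorem hasDerivAt_hRInvDeriv {R₁ R₂ ρ : ℝ} (hc : Real.pi / Real.log (R₂ / R₁) ≠ 0)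
    (hρ : 0 < ρ) :
    HasDerivAt (hRInvDeriv R₁ R₂)
      (hRInv R₁ R₂ ρ - Real.cosh ρ / Real.sinh ρ *
        Real.cos (Real.pi / Real.log (R₂ / R₁) *
          (Real.log R₂ - Real.log (Real.tanh (ρ / 2)))) -
        Real.pi / Real.log (R₂ / R₁) / Real.sinh ρ *
        Real.sin (Real.pi / Real.log (R₂ / R₁) *
          (Real.log R₂ - Real.log (Real.tanh (ρ / 2))))) ρ := by
  have hs : Real.sinh ρ ≠ 0 := (Real.sinh_pos_iff.2 hρ).ne'
  have h := (((Real.hasDerivAt_cosh ρ).fun_div (Real.hasDerivAt_sinh ρ) hs).fun_mul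
    (hasDerivAt_hRInv hc hρ)).fun_sub
      (hasDerivAt_angle (Real.pi / Real.log (R₂ / R₁)) (Real.log R₂) hρ).cos
  refine h.congr_deriv ?_
  simp only [hRInvDeriv, hRInv]
  generalize Real.pi / Real.log (R₂ / R₁) = c at *
  generalize c * (Real.log R₂ - Real.log (Real.tanh (ρ / 2))) = θ
  field_simp
  ring

theorem deriv_hR {R₁ R₂ ρ : ℝ} (hc : Real.pi / Real.log (R₂ / R₁) ≠ 0) (hρ : 0 < ρ)
    (hg : hRInv R₁ R₂ ρ ≠ 0) :
    deriv (hR R₁ R₂) ρ = -hRInvDeriv R₁ R₂ ρ / hRInv R₁ R₂ ρ ^ 2 := by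
  rw [hR_eq_inv]
  exact ((hasDerivAt_hRInv hc hρ).fun_inv hg).deriv

theorem deriv_deriv_hR {R₁ R₂ ρ g'' : ℝ} (hc : Real.pi / Real.log (R₂ / R₁) ≠ 0) (hρ : 0 < ρ)
    (hg : hRInv R₁ R₂ ρ ≠ 0) (hg'' : HasDerivAt (hRInvDeriv R₁ R₂) g'' ρ) :
    deriv (deriv (hR R₁ R₂)) ρ =
      -g'' / hRInv R₁ R₂ ρ ^ 2 + 2 * hRInvDeriv R₁ R₂ ρ ^ 2 / hRInv R₁ R₂ ρ ^ 3 := by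
  have hg' := hasDerivAt_hRInv hc hρ
  have hev : deriv (hR R₁ R₂) =ᶠ[𝓝 ρ] fun ρ => -hRInvDeriv R₁ R₂ ρ / hRInv R₁ R₂ ρ ^ 2 := by
    filter_upwards [lt_mem_nhds hρ, hg'.continuousAt.eventually_ne hg] with x hx hgx
    exact deriv_hR hc hx hgx
  rw [hev.deriv_eq, (hg''.fun_neg.fun_div (hg'.fun_pow 2) (pow_ne_zero 2 hg)).deriv]
  field_simp
  ring

theorem tendsto_tanh_half_atTop :
    Tendsto (fun ρ : ℝ => Real.tanh (ρ / 2)) atTop (𝓝 1) := by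
  have he := Real.tendsto_exp_neg_atTop_nhds_zero
  have h : Tendsto (fun ρ : ℝ => (1 - Real.exp (-ρ)) / (1 + Real.exp (-ρ))) atTop (𝓝 1) := by
    simpa [Pi.div_def] using (he.const_sub 1).div (he.const_add 1) (by norm_num)
  refine h.congr fun ρ => ?_
  have h1 : Real.exp (-ρ) = Real.exp (-(ρ / 2)) * Real.exp (-(ρ / 2)) := by
    rw [← Real.exp_add]; congr 1; ring
  have h2 : Real.exp (ρ / 2) * Real.exp (-(ρ / 2)) = 1 := by
    rw [← Real.exp_add, add_neg_cancel, Real.exp_zero]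
  rw [Real.tanh_eq, div_eq_div_iff (by positivity) (by positivity), h1]
  linear_combination (-2) * Real.exp (-(ρ / 2)) * h2

theorem tendsto_sinh_atTop : Tendsto Real.sinh atTop atTop :=
  tendsto_atTop_mono' _ ((eventually_ge_atTop 0).mono fun _ hx => Real.self_le_sinh_iff.2 hx)
    tendsto_id

theorem tendsto_sinh_mul_neg_log_tanh_half :
    Tendsto (fun ρ : ℝ => Real.sinh ρ * -Real.log (Real.tanh (ρ / 2))) atTop (𝓝 1) := by
  have hx := tendsto_tanh_half_atTop
  have hlo : Tendsto (fun ρ : ℝ => 2 * Real.tanh (ρ / 2) / (1 + Real.tanh (ρ / 2)))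
      atTop (𝓝 1) := by
    simpa [one_add_one_eq_two, Pi.div_def] using (hx.const_mul 2).div (hx.const_add 1) (by norm_num)
  have hup : Tendsto (fun ρ : ℝ => 2 / (1 + Real.tanh (ρ / 2))) atTop (𝓝 1) := by
    simpa [one_add_one_eq_two, Pi.div_def] using
      (tendsto_const_nhds (x := (2 : ℝ))).div (hx.const_add 1) (by norm_num)
  have key : ∀ ρ : ℝ, 0 < ρ → 0 < Real.tanh (ρ / 2) ∧ Real.tanh (ρ / 2) < 1 ∧
      Real.sinh ρ = 2 * Real.tanh (ρ / 2) / (1 - Real.tanh (ρ / 2) ^ 2) := by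
    intro ρ hρ
    have hs : 0 < Real.sinh (ρ / 2) := Real.sinh_pos_iff.2 (by linarith)
    have hc : 0 < Real.cosh (ρ / 2) := Real.cosh_pos _
    have hsinh : Real.sinh ρ = 2 * Real.sinh (ρ / 2) * Real.cosh (ρ / 2) := by
      rw [← Real.sinh_two_mul]; congr 1; ring
    have hsq := Real.cosh_sq (ρ / 2)
    have h1 : 1 - (Real.sinh (ρ / 2) / Real.cosh (ρ / 2)) ^ 2 = 1 / Real.cosh (ρ / 2) ^ 2 := by
      field_simp
      linarith
    rw [Real.tanh_eq_sinh_div_cosh]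
    refine ⟨div_pos hs hc, (div_lt_one hc).2 (Real.sinh_lt_cosh _), ?_⟩
    rw [h1, hsinh]
    field_simp
  refine tendsto_of_tendsto_of_tendsto_of_le_of_le' hlo hup ?_ ?_
  · filter_upwards [eventually_gt_atTop 0] with ρ hρ
    obtain ⟨h0, h1, hs⟩ := key ρ hρ
    rw [hs]
    have hl := Real.log_le_sub_one_of_pos h0
    generalize Real.tanh (ρ / 2) = x at *
    have h2 : 0 < 1 - x ^ 2 := by nlinarith
    calc 2 * x / (1 + x) = 2 * x / (1 - x ^ 2) * (1 - x) := by
          field_simp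
          ring
      _ ≤ _ := by gcongr; linarith
  · filter_upwards [eventually_gt_atTop 0] with ρ hρ
    obtain ⟨h0, h1, hs⟩ := key ρ hρ
    rw [hs]
    have hl := Real.one_sub_inv_le_log_of_pos h0
    generalize Real.tanh (ρ / 2) = x at *
    have h2 : 0 < 1 - x ^ 2 := by nlinarith
    calc 2 * x / (1 - x ^ 2) * -Real.log x ≤ 2 * x / (1 - x ^ 2) * (x⁻¹ - 1) := by
          gcongr; linarith
      _ = 2 / (1 + x) := by
          field_simp
          ring

theorem tendsto_cosh_div_sinh_atTop :
    Tendsto (fun ρ : ℝ => Real.cosh ρ / Real.sinh ρ) atTop (𝓝 1) := by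
  have h := (tendsto_tanh_half_atTop.comp (tendsto_id.const_mul_atTop (two_pos (α := ℝ)))).inv₀
    one_ne_zero
  simpa [Function.comp_def, Real.tanh_eq_sinh_div_cosh] using h

theorem exists_forall_density_bounds {δ : ℝ} (hδ : 0 < δ) :
    ∃ η > 0, ∀ A θ k w g g' g'' : ℝ, |A - 1| < η → |θ| < η → |k - 1| < η → |w| < η →
      g = A * Real.sinc θ → g' = k * g - Real.cos θ →
      g'' = g - k * Real.cos θ - w * Real.sin θ →
      g ≠ 0 ∧ |g⁻¹ - 1| ≤ δ ∧ |-g' / g ^ 2| ≤ δ ∧ |-g'' / g ^ 2 + 2 * g' ^ 2 / g ^ 3| ≤ δ := by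
  let p : ℝ × ℝ × ℝ × ℝ := (1, 0, 1, 0)
  let G : ℝ × ℝ × ℝ × ℝ → ℝ := fun q => q.1 * Real.sinc q.2.1
  let G' : ℝ × ℝ × ℝ × ℝ → ℝ := fun q => q.2.2.1 * G q - Real.cos q.2.1
  let G'' : ℝ × ℝ × ℝ × ℝ → ℝ :=
    fun q => G q - q.2.2.1 * Real.cos q.2.1 - q.2.2.2 * Real.sin q.2.1
  have hG : Continuous G := continuous_fst.mul (Real.continuous_sinc.comp (by fun_prop))
  have hG' : Continuous G' := by fun_prop
  have hG'' : Continuous G'' := by fun_prop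
  have tG : Tendsto G (𝓝 p) (𝓝 1) := by simpa [G, p] using hG.tendsto p
  have tG' : Tendsto G' (𝓝 p) (𝓝 0) := by simpa [G', G, p] using hG'.tendsto p
  have tG'' : Tendsto G'' (𝓝 p) (𝓝 0) := by simpa [G'', G, p] using hG''.tendsto p
  have t0 : Tendsto (fun q => |(G q)⁻¹ - 1|) (𝓝 p) (𝓝 0) := by
    simpa using ((tG.inv₀ one_ne_zero).sub_const 1).abs
  have t1 : Tendsto (fun q => |-G' q / G q ^ 2|) (𝓝 p) (𝓝 0) := by
    simpa using (tG'.neg.div (tG.pow 2) (by norm_num)).abs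
  have t2 : Tendsto (fun q => |-G'' q / G q ^ 2 + 2 * G' q ^ 2 / G q ^ 3|) (𝓝 p) (𝓝 0) := by
    simpa using ((tG''.neg.div (tG.pow 2) (by norm_num)).add
      (((tG'.pow 2).const_mul 2).div (tG.pow 3) (by norm_num))).abs
  obtain ⟨η, hη, H⟩ := Metric.eventually_nhds_iff.1 ((tG.eventually_ne one_ne_zero).and
    ((t0.eventually_le_const hδ).and ((t1.eventually_le_const hδ).and
      (t2.eventually_le_const hδ))))
  refine ⟨η, hη, ?_⟩
  rintro A θ k w g g' g'' hA hθ hk hw rfl rfl rfl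
  exact @H (A, θ, k, w) (by simp [p, Prod.dist_eq, Real.dist_eq, *])

theorem stmt_2 (R₁ : ℝ) (hR₁ : R₁ ∈ Set.Ioo (0 : ℝ) 1) (δ : ℝ) (hδ : 0 < δ) :
    ∃ ρstar > 0, ∀ ρ₀ ≥ ρstar, ∃ R : ℝ,
      Real.tanh ((ρ₀ + 1) / 2) < R ∧ R < 1 ∧
      ∀ R₂ ∈ Set.Icc R 1, ∀ ρ ∈ Set.Icc ρ₀ (ρ₀ + 1),
        |hR R₁ R₂ ρ - 1| ≤ δ ∧
        |deriv (hR R₁ R₂) ρ| ≤ δ ∧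
        |deriv (deriv (hR R₁ R₂)) ρ| ≤ δ := by
  obtain ⟨η, hη, H⟩ := exists_forall_density_bounds hδ
  obtain ⟨hR₁0, hR₁1⟩ := hR₁
  have hlogR₁ : Real.log R₁ < 0 := Real.log_neg hR₁0 hR₁1
  set C : ℝ := Real.pi / (-Real.log R₁ / 2) with hC
  have hC0 : 0 < C := div_pos Real.pi_pos (by linarith)
  have e1 := (tendsto_sinh_mul_neg_log_tanh_half.sub_const 1).abs.eventually_lt_const
    (u := η / 2) (by simpa using hη)
  have tlog : Tendsto (fun ρ : ℝ => C * -Real.log (Real.tanh (ρ / 2))) atTop (𝓝 0) := by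
    simpa using (tendsto_tanh_half_atTop.log one_ne_zero).neg.const_mul C
  have e2 := tlog.eventually_lt_const hη
  have e3 := (tendsto_cosh_div_sinh_atTop.sub_const 1).abs.eventually_lt_const
    (u := η) (by simpa using hη)
  have e4 := (tendsto_sinh_atTop.const_div_atTop C).eventually_lt_const hη
  obtain ⟨ρs, hρs⟩ := eventually_atTop.1 (e1.and (e2.and (e3.and e4)))
  refine ⟨max ρs 1, by positivity, fun ρ₀ hρ₀ => ?_⟩
  have hρ₀s : ρs ≤ ρ₀ := (le_max_left _ _).trans hρ₀
  have hρ₀1 : 1 ≤ ρ₀ := (le_max_right _ _).trans hρ₀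
  have hsinh : 0 < Real.sinh (ρ₀ + 1) := Real.sinh_pos_iff.2 (by linarith)
  have tl : Tendsto Real.log (𝓝[<] 1) (𝓝 0) := by
    simpa using (Real.continuousAt_log one_ne_zero).tendsto.mono_left
      (nhdsWithin_le_nhds (s := Set.Iio 1))
  have ts : Tendsto (fun R => Real.sinh (ρ₀ + 1) * -Real.log R) (𝓝[<] 1) (𝓝 0) := by
    simpa using tl.neg.const_mul (Real.sinh (ρ₀ + 1))
  obtain ⟨R, hRt, hR1, hRlog, hRs⟩ :=
    ((eventually_nhdsWithin_of_eventually_nhds (lt_mem_nhds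
        (Real.tanh_lt_one ((ρ₀ + 1) / 2)))).and
      ((eventually_mem_nhdsWithin (a := (1 : ℝ)) (s := Set.Iio 1)).and
      ((tl.eventually_const_lt (show Real.log R₁ / 2 < 0 by linarith)).and
        (ts.eventually_lt_const (half_pos hη))))).exists
  refine ⟨R, hRt, hR1, fun R₂ hR₂ ρ hρ => ?_⟩
  obtain ⟨b1, b2, b3, b4⟩ := hρs ρ (hρ₀s.trans hρ.1)
  have hρ0 : 0 < ρ := by linarith [hρ.1]
  have htanh : 0 < Real.tanh (ρ / 2) := by
    rw [Real.tanh_eq_sinh_div_cosh]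
    exact div_pos (Real.sinh_pos_iff.2 (by linarith)) (Real.cosh_pos _)
  have htle : Real.tanh (ρ / 2) ≤ Real.tanh ((ρ₀ + 1) / 2) :=
    (Real.artanh_le_artanh_iff ⟨Real.neg_one_lt_tanh _, Real.tanh_lt_one _⟩
      ⟨Real.neg_one_lt_tanh _, Real.tanh_lt_one _⟩).1
      (by simp only [Real.artanh_tanh]; linarith [hρ.2])
  have hRpos : 0 < R := by linarith
  have hR₂pos : 0 < R₂ := hRpos.trans_le hR₂.1
  have ha : Real.log R ≤ Real.log R₂ := Real.log_le_log hRpos hR₂.1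
  have ha0 : Real.log R₂ ≤ 0 := Real.log_nonpos hR₂pos.le hR₂.2
  have hu : Real.log (Real.tanh (ρ / 2)) ≤ Real.log R₂ :=
    Real.log_le_log htanh (by linarith [hR₂.1])
  have hL : Real.log (R₂ / R₁) = Real.log R₂ - Real.log R₁ :=
    Real.log_div hR₂pos.ne' hR₁0.ne'
  have hc0 : 0 < Real.pi / Real.log (R₂ / R₁) := div_pos Real.pi_pos (by linarith)
  have hcC : Real.pi / Real.log (R₂ / R₁) ≤ C := by
    rw [hC]
    exact div_le_div_of_nonneg_left Real.pi_pos.le (by linarith) (by linarith)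
  have hs0 : 0 < Real.sinh ρ := Real.sinh_pos_iff.2 hρ0
  have hsle : Real.sinh ρ ≤ Real.sinh (ρ₀ + 1) := Real.sinh_le_sinh.2 hρ.2
  have hsa : Real.sinh ρ * -Real.log R₂ < η / 2 :=
    (mul_le_mul hsle (neg_le_neg ha) (by linarith) hsinh.le).trans_lt hRs
  have hsa0 : 0 ≤ Real.sinh ρ * -Real.log R₂ := mul_nonneg hs0.le (by linarith)
  set c := Real.pi / Real.log (R₂ / R₁) with hc
  set u := Real.log R₂ - Real.log (Real.tanh (ρ / 2)) with hu_def
  have hu0 : 0 ≤ u := by linarith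
  obtain ⟨hg, h0, h1, h2⟩ := H (Real.sinh ρ * u) (c * u) (Real.cosh ρ / Real.sinh ρ)
    (c / Real.sinh ρ) (hRInv R₁ R₂ ρ) (hRInvDeriv R₁ R₂ ρ) _
    (by
      rw [abs_lt] at b1 ⊢
      constructor <;> simp only [hu_def] <;> linarith [b1.1, b1.2])
    (by
      rw [abs_of_nonneg (by positivity)]
      exact (mul_le_mul hcC (by linarith) hu0 hC0.le).trans_lt b2)
    b3
    (by
      rw [abs_of_pos (by positivity)]
      exact (div_le_div_of_nonneg_right hcC hs0.le).trans_lt b4)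
    (by
      simp only [hRInv, ← hc, ← hu_def]
      rcases eq_or_ne u 0 with h | h
      · simp [h]
      · rw [Real.sinc_of_ne_zero (mul_ne_zero hc0.ne' h)]
        field_simp)
    rfl rfl
  refine ⟨?_, ?_, ?_⟩
  · rwa [hR_eq_inv]
  · rwa [deriv_hR hc0.ne' hρ0 hg]
  · rwa [deriv_deriv_hR hc0.ne' hρ0 hg (hasDerivAt_hRInvDeriv hc0.ne' hρ0)]
end

section
/- Let R₁ ∈ (0,1) and δ ∈ (0,1). Let h_O(ρ) := 1/(sinh ρ · log(coth(ρ/2))) and, for R₂ ∈ (R₁,1], h_{R₁,R₂}(ρ) := (π / log(R₂/R₁)) · 1/(sinh ρ · sin(π·(log R₂ − log tanh(ρ/2)) / log(R₂/R₁))). For a positive C² function h define its curvature K_h(ρ) := −(1/h(ρ)²)·( (log∘h)''(ρ) + (log∘h)'(ρ)·coth ρ + 1 ). Then there exists ρ* > 0 such that for every ρ₀ ≥ ρ*, there exists R(ρ₀) with tanh((ρ₀+1)/2) < R(ρ₀) < 1 such that for every R₂ ∈ [R(ρ₀), 1], there exists a smooth positive function h on the open interval I := {ρ : R₁ < tanh(ρ/2)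 < R₂} satisfying: (1) h(ρ) = h_{R₁,R₂}(ρ) for ρ ∈ I with ρ ≤ ρ₀; (2) h(ρ) = h_O(ρ) for ρ ∈ I with ρ ≥ ρ₀ + 1; (3) h_O(ρ) ≤ h(ρ) ≤ h_{R₁,R₂}(ρ) for all ρ ∈ I; and (4) |K_h(ρ) + 1| ≤ δ for all ρ ∈ I. -/
/-- Density of the Poincaré metric of the punctured unit disc in hyperbolic
polar coordinates. -/
noncomputable def hO : ℝ → ℝ :=
  fun ρ => 1 / (Real.sinh ρ * Real.log (Real.cosh (ρ / 2) / Real.sinh (ρ / 2)))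

/-- The Gaussian curvature of the rotationally symmetric metric
`h(ρ)² (dρ² + sinh²ρ dθ²)`. -/
noncomputable def curvK (h : ℝ → ℝ) : ℝ → ℝ :=
  fun ρ => -(1 / (h ρ) ^ 2) *
    (deriv (deriv (fun x => Real.log (h x))) ρ +
      deriv (fun x => Real.log (h x)) ρ * (Real.cosh ρ / Real.sinh ρ) + 1)

open Real Set Filter Topology

/-- The coordinate `log (coth (ρ / 2)) = -log |z|`, in which both metrics are conformal to the
flat cylinder. -/
noncomputable def logCothHalf (x : ℝ) : ℝ := log (cosh (x / 2) / sinh (x / 2))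

lemma sinh_eq_two_mul_half (x : ℝ) : sinh x = 2 * sinh (x / 2) * cosh (x / 2) := by
  rw [← sinh_two_mul]; congr 1; ring

lemma sinh_half_pos {x : ℝ} (hx : 0 < x) : 0 < sinh (x / 2) := sinh_pos_iff.2 (by linarith)

lemma hasDerivAt_logCothHalf {x : ℝ} (hx : 0 < x) :
    HasDerivAt logCothHalf (-(1 / sinh x)) x := by
  have hs := sinh_half_pos hx
  have hc := cosh_pos (x / 2)
  have h2 : HasDerivAt (fun y : ℝ => y / 2) (1 / 2) x := (hasDerivAt_id x).div_const 2
  have h := (h2.cosh.div h2.sinh hs.ne').log (div_pos hc hs).ne'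
  refine h.congr_deriv ?_
  rw [sinh_eq_two_mul_half x]
  have e := cosh_sq (x / 2)
  simp only [Pi.div_apply]
  field_simp
  linear_combination (-1) * e

lemma logCothHalf_eq_neg_log_tanh (x : ℝ) : logCothHalf x = -log (tanh (x / 2)) := by
  rw [logCothHalf, tanh_eq_sinh_div_cosh, ← log_inv, inv_div]

lemma logCothHalf_pos {x : ℝ} (hx : 0 < x) : 0 < logCothHalf x := by
  apply log_pos
  rw [one_lt_div (sinh_half_pos hx)]
  exact sinh_lt_cosh _

lemma logCothHalf_mul_sinh_le {x : ℝ} (hx : 0 < x) : logCothHalf x * sinh x ≤ 2 := by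
  have hs := sinh_half_pos hx
  have hc := cosh_pos (x / 2)
  have h1 : logCothHalf x ≤ cosh (x / 2) / sinh (x / 2) - 1 := log_le_sub_one_of_pos (by positivity)
  have h2 : (cosh (x / 2) / sinh (x / 2) - 1) * sinh x ≤ 2 := by
    rw [sinh_eq_two_mul_half x]
    have e := cosh_sq (x / 2)
    have : (cosh (x / 2) / sinh (x / 2) - 1) * (2 * sinh (x / 2) * cosh (x / 2)) =
        2 * (cosh (x / 2) - sinh (x / 2)) * cosh (x / 2) := by field_simp
    nlinarith [sinh_lt_cosh (x / 2)]
  exact (mul_le_mul_of_nonneg_right h1 (sinh_pos_iff.2 hx).le).trans h2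

lemma logCothHalf_antitoneOn : AntitoneOn logCothHalf (Ioi 0) := by
  apply antitoneOn_of_deriv_nonpos (convex_Ioi 0)
  · exact fun x hx => (hasDerivAt_logCothHalf hx).continuousAt.continuousWithinAt
  · rw [interior_Ioi]
    exact fun x hx => (hasDerivAt_logCothHalf hx).differentiableAt.differentiableWithinAt
  · rw [interior_Ioi]
    intro x hx
    rw [(hasDerivAt_logCothHalf hx).deriv]
    have := sinh_pos_iff.2 hx
    simp only [Left.neg_nonpos_iff]
    positivity

lemma tanh_half_eq_exp {x : ℝ} (hx : 0 < x) : tanh (x / 2) = exp (-logCothHalf x) := by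
  rw [logCothHalf_eq_neg_log_tanh, neg_neg, exp_log]
  rw [tanh_eq_sinh_div_cosh]
  exact div_pos (sinh_half_pos hx) (cosh_pos _)

lemma pos_of_tanh_half_pos {x : ℝ} (hx : 0 < tanh (x / 2)) : 0 < x := by
  rw [tanh_eq_sinh_div_cosh, div_pos_iff_of_pos_right (cosh_pos _), sinh_pos_iff] at hx
  linarith

/-- With `c = π / L`, the logarithm of the ratio of the Poincaré densities of the annulus and of
the punctured disc, in the coordinate `t = -log |z|`. -/
noncomputable def logRatio (c a t : ℝ) : ℝ := log t + log c - log (sin (c * (t - a)))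

lemma hasDerivAt_logRatio {c a t : ℝ} (ht : t ≠ 0) (hs : sin (c * (t - a)) ≠ 0) :
    HasDerivAt (logRatio c a)
      (1 / t - c * cos (c * (t - a)) / sin (c * (t - a))) t := by
  have h2 : HasDerivAt (fun t : ℝ => c * (t - a)) c t := by
    simpa using ((hasDerivAt_id t).sub_const a).const_mul c
  refine (((hasDerivAt_id t).log ht).add_const (log c)).sub (h2.sin.log hs) |>.congr_deriv ?_
  simp only [id]
  ring

lemma hasDerivAt_logRatio_deriv {c a t : ℝ} (ht : t ≠ 0) (hs : sin (c * (t - a)) ≠ 0) :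
    HasDerivAt (fun t => 1 / t - c * cos (c * (t - a)) / sin (c * (t - a)))
      (-(1 / t ^ 2) + c ^ 2 / sin (c * (t - a)) ^ 2) t := by
  have h2 : HasDerivAt (fun t : ℝ => c * (t - a)) c t := by
    simpa using ((hasDerivAt_id t).sub_const a).const_mul c
  have := ((hasDerivAt_id t).inv ht).sub ((h2.cos.const_mul c).div h2.sin hs)
  simp only [one_div]
  refine this.congr_deriv ?_
  have e := sin_sq_add_cos_sq (c * (t - a))
  simp only [id]
  field_simp
  linear_combination (c ^ 2 * t ^ 2) * e

lemma sin_mul_pos {c a t : ℝ} (hc : 0 < c) (ha : a < t) (ht : c * (t - a) < π) :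
    0 < sin (c * (t - a)) :=
  sin_pos_of_pos_of_lt_pi (mul_pos hc (by linarith)) ht

lemma logRatio_nonneg {c a t : ℝ} (hc : 0 < c) (ha : 0 ≤ a) (hat : a < t)
    (ht : c * (t - a) < π) : 0 ≤ logRatio c a t := by
  have h0 := sin_mul_pos hc hat ht
  have h1 : sin (c * (t - a)) ≤ t * c :=
    (sin_le (mul_pos hc (by linarith)).le).trans (by nlinarith)
  have := log_le_log h0 h1
  rw [log_mul (by linarith) hc.ne'] at this
  rw [logRatio]; linarith

lemma div_sin_sq_le {y : ℝ} (h0 : 0 < y) (h1 : y ≤ 1) : (y / sin y) ^ 2 ≤ 1 + y ^ 2 := by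
  have hs : 0 < y * (1 - y ^ 2 / 4) := mul_pos h0 (by nlinarith)
  have h2 : y * (1 - y ^ 2 / 4) ≤ sin y := by
    nlinarith [sin_gt_sub_cube h0, pow_pos h0 3]
  have h3 : 0 < sin y := hs.trans_le h2
  rw [div_pow, div_le_iff₀ (by positivity)]
  have h4 : (y * (1 - y ^ 2 / 4)) ^ 2 ≤ sin y ^ 2 := by gcongr
  have hz : y ^ 2 ≤ 1 := by nlinarith
  have h5 : 1 ≤ (1 + y ^ 2) * (1 - y ^ 2 / 4) ^ 2 := by
    nlinarith [mul_nonneg (sq_nonneg y) (sub_nonneg.2 hz), sq_nonneg y, sq_nonneg (y ^ 2),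
      mul_nonneg (sq_nonneg (y ^ 2)) (sq_nonneg y)]
  calc y ^ 2 ≤ y ^ 2 * ((1 + y ^ 2) * (1 - y ^ 2 / 4) ^ 2) := le_mul_of_one_le_right (by positivity) h5
    _ = (1 + y ^ 2) * (y * (1 - y ^ 2 / 4)) ^ 2 := by ring
    _ ≤ _ := by gcongr

lemma log_div_sin_le {y : ℝ} (h0 : 0 < y) (h1 : y ≤ 1) : log (y / sin y) ≤ y ^ 2 := by
  have h3 : 0 < sin y := sin_pos_of_pos_of_lt_pi h0 (by linarith [pi_gt_three])
  have h := div_sin_sq_le h0 h1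
  have h4 := log_le_sub_one_of_pos (div_pos h0 h3)
  have h5 : 1 ≤ y / sin y := (one_le_div h3).2 (sin_le h0.le)
  nlinarith

lemma one_sub_mul_cot_nonneg {y : ℝ} (h0 : 0 < y) (h1 : y ≤ 1) : y * cos y / sin y ≤ 1 := by
  have h3 : 0 < sin y := sin_pos_of_pos_of_lt_pi h0 (by linarith [pi_gt_three])
  have hp : y < π / 2 := by linarith [pi_gt_three]
  have hc : 0 < cos y := cos_pos_of_mem_Ioo ⟨by linarith, hp⟩
  have := lt_tan h0 hp
  rw [tan_eq_sin_div_cos, lt_div_iff₀ hc] at this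
  exact (div_le_one h3).2 this.le

lemma one_sub_mul_cot_le {y : ℝ} (h0 : 0 < y) (h1 : y ≤ 1) : 1 - y * cos y / sin y ≤ y ^ 2 := by
  have h3 : 0 < sin y := sin_pos_of_pos_of_lt_pi h0 (by linarith [pi_gt_three])
  have h2 : y * (1 - y ^ 2 / 4) ≤ sin y := by
    nlinarith [sin_gt_sub_cube h0, pow_pos h0 3]
  have h4 : y * (1 - y ^ 2 / 2) ≤ y * cos y := mul_le_mul_of_nonneg_left one_sub_sq_div_two_le_cos h0.le
  have hz : y ^ 2 ≤ 1 := by nlinarith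
  have h5 := sin_le h0.le
  rw [sub_le_iff_le_add', ← sub_le_iff_le_add, le_div_iff₀ h3]
  have h6 : (1 - y ^ 2) * sin y ≤ (1 - y ^ 2) * y := mul_le_mul_of_nonneg_left h5 (by linarith)
  nlinarith [pow_pos h0 3]

section Estimates

variable {c a t : ℝ}

lemma logRatio_le (hc : 0 < c) (ht : 0 < t) (ha : 0 ≤ a) (hat : a ≤ t / 2) (hat3 : a ≤ t ^ 3)
    (hct : c * t ≤ 1) : logRatio c a t ≤ (2 + c ^ 2) * t ^ 2 := by
  have hs : 0 < t - a := by linarith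
  have hy : 0 < c * (t - a) := by positivity
  have hy1 : c * (t - a) ≤ 1 := by nlinarith
  have hsin : 0 < sin (c * (t - a)) := sin_pos_of_pos_of_lt_pi hy (by linarith [pi_gt_three])
  have h1 := log_div_sin_le hy hy1
  rw [log_div hy.ne' hsin.ne', log_mul hc.ne' hs.ne'] at h1
  have h2 : log (t / (t - a)) ≤ t / (t - a) - 1 := log_le_sub_one_of_pos (by positivity)
  rw [log_div ht.ne' hs.ne'] at h2
  have h3 : t / (t - a) - 1 ≤ 2 * t ^ 2 := by
    rw [sub_le_iff_le_add, div_le_iff₀ hs]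
    nlinarith [pow_pos ht 2, mul_le_mul_of_nonneg_left hat (pow_pos ht 2).le]
  have h4 : (c * (t - a)) ^ 2 ≤ (c * t) ^ 2 := by gcongr; linarith
  rw [logRatio]
  nlinarith

lemma abs_deriv_logRatio_le (hc : 0 < c) (ht : 0 < t) (ha : 0 ≤ a) (hat : a ≤ t / 2)
    (hat3 : a ≤ t ^ 3) (hct : c * t ≤ 1) :
    |1 / t - c * cos (c * (t - a)) / sin (c * (t - a))| ≤ (2 + c ^ 2) * t := by
  have hs : 0 < t - a := by linarith
  have hy : 0 < c * (t - a) := by positivity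
  have hy1 : c * (t - a) ≤ 1 := by nlinarith
  have hsin : 0 < sin (c * (t - a)) := sin_pos_of_pos_of_lt_pi hy (by linarith [pi_gt_three])
  have h1 := one_sub_mul_cot_nonneg hy hy1
  have h2 := one_sub_mul_cot_le hy hy1
  set q := c * (t - a) * cos (c * (t - a)) / sin (c * (t - a)) with hq
  have e : 1 / t - c * cos (c * (t - a)) / sin (c * (t - a)) =
      (1 / t - 1 / (t - a)) + (1 - q) / (t - a) := by
    rw [hq]; field_simp; ring
  have h3 : 1 / (t - a) - 1 / t ≤ 2 * t := by
    rw [div_sub_div _ _ hs.ne' ht.ne', div_le_iff₀ (by positivity)]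
    nlinarith [mul_le_mul_of_nonneg_left hat (pow_pos ht 2).le]
  have h4 : 1 / t ≤ 1 / (t - a) := one_div_le_one_div_of_le hs (by linarith)
  have h5 : 0 ≤ (1 - q) / (t - a) := div_nonneg (by linarith) hs.le
  have h6 : (1 - q) / (t - a) ≤ c ^ 2 * t := by
    rw [div_le_iff₀ hs]
    nlinarith [mul_nonneg (mul_nonneg (sq_nonneg c) hs.le) ha]
  have h7 : 0 ≤ c ^ 2 * t := by positivity
  rw [e, abs_le]
  constructor <;> nlinarith

lemma abs_deriv_deriv_logRatio_le (hc : 0 < c) (ht : 0 < t) (ha : 0 ≤ a) (hat : a ≤ t / 2)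
    (hat3 : a ≤ t ^ 3) (hct : c * t ≤ 1) :
    |-(1 / t ^ 2) + c ^ 2 / sin (c * (t - a)) ^ 2| ≤ 8 + c ^ 2 := by
  have hs : 0 < t - a := by linarith
  have hy : 0 < c * (t - a) := by positivity
  have hy1 : c * (t - a) ≤ 1 := by nlinarith
  have hsin : 0 < sin (c * (t - a)) := sin_pos_of_pos_of_lt_pi hy (by linarith [pi_gt_three])
  have h1 := div_sin_sq_le hy hy1
  have h2 : 1 ≤ (c * (t - a) / sin (c * (t - a))) ^ 2 :=
    one_le_pow₀ ((one_le_div hsin).2 (sin_le hy.le))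
  set q := (c * (t - a) / sin (c * (t - a))) ^ 2 with hq
  have e : -(1 / t ^ 2) + c ^ 2 / sin (c * (t - a)) ^ 2 =
      (1 / (t - a) ^ 2 - 1 / t ^ 2) + (q - 1) / (t - a) ^ 2 := by
    rw [hq]; field_simp; ring
  have h3 : 1 / (t - a) ^ 2 - 1 / t ^ 2 ≤ 8 := by
    rw [div_sub_div _ _ (by positivity) (by positivity), div_le_iff₀ (by positivity)]
    have : t / 2 ≤ t - a := by linarith
    have h8 : (t / 2) ^ 2 ≤ (t - a) ^ 2 := by gcongr
    nlinarith [mul_le_mul_of_nonneg_right h8 (pow_pos ht 2).le,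
      mul_le_mul_of_nonneg_right hat3 ht.le, mul_nonneg ha ht.le]
  have h4 : 1 / t ^ 2 ≤ 1 / (t - a) ^ 2 := by
    apply one_div_le_one_div_of_le (by positivity); gcongr; linarith
  have h5 : 0 ≤ (q - 1) / (t - a) ^ 2 := div_nonneg (by linarith) (by positivity)
  have h6 : (q - 1) / (t - a) ^ 2 ≤ c ^ 2 := by
    rw [div_le_iff₀ (by positivity)]
    linarith
  rw [e, abs_le]
  constructor <;> nlinarith

end Estimates

lemma hO_eq (x : ℝ) : hO x = 1 / (sinh x * logCothHalf x) := rfl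

lemma hO_pos {x : ℝ} (hx : 0 < x) : 0 < hO x :=
  one_div_pos.2 (mul_pos (sinh_pos_iff.2 hx) (logCothHalf_pos hx))

lemma log_hO {x : ℝ} (hx : 0 < x) : log (hO x) = -log (sinh x) - log (logCothHalf x) := by
  rw [hO_eq, one_div, log_inv, log_mul (sinh_pos_iff.2 hx).ne' (logCothHalf_pos hx).ne']
  ring

/-- Curvature of a conformal change of the Poincaré metric of the punctured disc. -/
lemma curvK_hO_mul_exp {h g g' : ℝ → ℝ} {g'' ρ : ℝ} (hρ : 0 < ρ)
    (hh : ∀ᶠ x in 𝓝 ρ, h x = hO x * exp (g x)) (hg : ∀ᶠ x in 𝓝 ρ, HasDerivAt g (g' x) x)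
    (hg' : HasDerivAt g' g'' ρ) :
    curvK h ρ = -(1 / h ρ ^ 2) *
      (1 / (sinh ρ * logCothHalf ρ) ^ 2 + g'' + g' ρ * (cosh ρ / sinh ρ)) := by
  have hpos : ∀ᶠ x in 𝓝 ρ, 0 < x := lt_mem_nhds hρ
  have hlog : (fun x => log (h x)) =ᶠ[𝓝 ρ]
      fun x => -log (sinh x) - log (logCothHalf x) + g x := by
    filter_upwards [hpos, hh] with x hx hhx
    rw [hhx, log_mul (hO_pos hx).ne' (exp_pos _).ne', log_exp, log_hO hx]
  have hd : ∀ᶠ x in 𝓝 ρ, HasDerivAt (fun x => -log (sinh x) - log (logCothHalf x) + g x)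
      (-(cosh x / sinh x) + 1 / (sinh x * logCothHalf x) + g' x) x := by
    filter_upwards [hpos, hg] with x hx hgx
    have hs := sinh_pos_iff.2 hx
    have ht := logCothHalf_pos hx
    refine (((hasDerivAt_sinh x).log hs.ne').neg.sub
      ((hasDerivAt_logCothHalf hx).log ht.ne')).add hgx |>.congr_deriv ?_
    field_simp
    ring
  have hderiv : deriv (fun x => log (h x)) =ᶠ[𝓝 ρ]
      fun x => -(cosh x / sinh x) + 1 / (sinh x * logCothHalf x) + g' x := by
    filter_upwards [hlog.eventuallyEq_nhds, hd] with x hx hdx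
    rw [hx.deriv_eq, hdx.deriv]
  have hs := sinh_pos_iff.2 hρ
  have ht := logCothHalf_pos hρ
  have hdd : HasDerivAt (fun x => -(cosh x / sinh x) + 1 / (sinh x * logCothHalf x) + g' x)
      (1 / sinh ρ ^ 2 - (cosh ρ * logCothHalf ρ - 1) / (sinh ρ * logCothHalf ρ) ^ 2 + g'') ρ := by
    have h1 := ((hasDerivAt_cosh ρ).div (hasDerivAt_sinh ρ) hs.ne').neg
    have h2 := (((hasDerivAt_sinh ρ).mul (hasDerivAt_logCothHalf hρ))).inv
      (mul_pos hs ht).ne'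
    simp only [one_div]
    refine ((h1.add h2).add hg').congr_deriv ?_
    have e := cosh_sq ρ
    simp only [Pi.mul_apply]
    field_simp
    linear_combination (logCothHalf ρ ^ 2) * e
  rw [curvK, hderiv.deriv_eq, hderiv.eq_of_nhds, hdd.deriv]
  congr 1
  have e := cosh_sq ρ
  field_simp
  linear_combination (-logCothHalf ρ ^ 2) * e

lemma curvK_blend {h χ χ' u u' : ℝ → ℝ} {χ'' u'' ρ : ℝ} (hρ : 0 < ρ)
    (hh : ∀ᶠ x in 𝓝 ρ, h x = hO x * exp (χ x * u (logCothHalf x)))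
    (hχ : ∀ x, HasDerivAt χ (χ' x) x) (hχ' : HasDerivAt χ' χ'' ρ)
    (hu : ∀ᶠ t in 𝓝 (logCothHalf ρ), HasDerivAt u (u' t) t)
    (hu' : HasDerivAt u' u'' (logCothHalf ρ)) :
    curvK h ρ = -(1 / h ρ ^ 2) * (1 / (sinh ρ * logCothHalf ρ) ^ 2 +
      (χ ρ * u'' / sinh ρ ^ 2 + χ'' * u (logCothHalf ρ)
        - 2 * χ' ρ * u' (logCothHalf ρ) / sinh ρ
        + χ' ρ * u (logCothHalf ρ) * (cosh ρ / sinh ρ))) := by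
  have hpos : ∀ᶠ x in 𝓝 ρ, 0 < x := lt_mem_nhds hρ
  have hs := sinh_pos_iff.2 hρ
  have hg : ∀ᶠ x in 𝓝 ρ, HasDerivAt (fun x => χ x * u (logCothHalf x))
      (χ' x * u (logCothHalf x) + χ x * (u' (logCothHalf x) * -(1 / sinh x))) x := by
    filter_upwards [hpos, (hasDerivAt_logCothHalf hρ).continuousAt.eventually hu] with x hx hux
    exact (hχ x).mul (hux.comp x (hasDerivAt_logCothHalf hx))
  have hτ := hasDerivAt_logCothHalf hρ
  have hg' : HasDerivAt
      (fun x => χ' x * u (logCothHalf x) + χ x * (u' (logCothHalf x) * -(1 / sinh x)))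
      ((χ'' * u (logCothHalf ρ) + χ' ρ * (u' (logCothHalf ρ) * -(1 / sinh ρ))) +
        (χ' ρ * (u' (logCothHalf ρ) * -(1 / sinh ρ)) + χ ρ * (u'' / sinh ρ ^ 2 +
          u' (logCothHalf ρ) * (cosh ρ / sinh ρ ^ 2)))) ρ := by
    have h1 := hχ'.mul (hu.self_of_nhds.comp ρ hτ)
    have h2 := (hχ ρ).mul ((hu'.comp ρ hτ).mul ((hasDerivAt_sinh ρ).inv hs.ne').neg)
    simp only [one_div] at h1 h2 ⊢
    refine (h1.add h2).congr_deriv ?_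
    simp only [Function.comp_apply, Pi.neg_apply, Pi.inv_apply, Pi.mul_apply]
    field_simp
  rw [curvK_hO_mul_exp hρ hh hg hg']
  congr 1
  field_simp
  ring

lemma abs_curvature_add_one_le {s C t u u' u'' χ χ' χ'' M B : ℝ} (hs : 1 ≤ s) (hC0 : 0 ≤ C)
    (hC : C ≤ 2 * s) (ht : 0 < t) (hts : t * s ≤ 2) (hM : 0 ≤ M) (hB : 1 ≤ B) (hu0 : 0 ≤ u)
    (hu : u ≤ M * t ^ 2) (hu' : |u'| ≤ M * t) (hu'' : |u''| ≤ M) (hχ0 : 0 ≤ χ) (hχ1 : χ ≤ 1)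
    (hχ' : |χ'| ≤ B) (hχ'' : |χ''| ≤ B) :
    |-(1 / (1 / (s * t) * exp (χ * u)) ^ 2) * (1 / (s * t) ^ 2 +
      (χ * u'' / s ^ 2 + χ'' * u - 2 * χ' * u' / s + χ' * u * (C / s))) + 1|
      ≤ 76 * M * B / s ^ 2 := by
  have hs0 : 0 < s := by linarith
  set w := 1 / s with hw
  have hw0 : 0 < w := by positivity
  have htw : t ≤ 2 * w := by
    rw [hw, mul_one_div, le_div_iff₀ hs0]; exact hts
  have hCs0 : 0 ≤ C / s := by positivity
  have hCs : C / s ≤ 2 := by rwa [div_le_iff₀ hs0]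
  have ht2 : t ^ 2 ≤ 4 * w ^ 2 := by nlinarith
  have hu4 : u ≤ M * (4 * w ^ 2) := hu.trans (by gcongr)
  have e1 : |χ * u'' / s ^ 2| ≤ B * M * w ^ 2 := by
    rw [show χ * u'' / s ^ 2 = χ * u'' * w ^ 2 by rw [hw]; field_simp, abs_mul, abs_mul,
      abs_of_nonneg hχ0, abs_of_nonneg (sq_nonneg w)]
    gcongr
    linarith
  have e2 : |χ'' * u| ≤ B * (M * (4 * w ^ 2)) := by
    rw [abs_mul, abs_of_nonneg hu0]
    gcongr
  have e3 : |2 * χ' * u' / s| ≤ 2 * B * (M * (2 * w)) * w := by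
    rw [show 2 * χ' * u' / s = 2 * χ' * u' * w by rw [hw]; field_simp, abs_mul, abs_mul, abs_mul,
      abs_of_pos hw0, abs_two]
    gcongr
    exact hu'.trans (by gcongr)
  have e4 : |χ' * u * (C / s)| ≤ B * (M * (4 * w ^ 2)) * 2 := by
    rw [abs_mul, abs_mul, abs_of_nonneg hu0, abs_of_nonneg hCs0]
    gcongr
  set E := χ * u'' / s ^ 2 + χ'' * u - 2 * χ' * u' / s + χ' * u * (C / s) with hE
  have hEle : |E| ≤ 17 * (M * B * w ^ 2) := by
    rw [abs_le] at *
    constructor <;> linarith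
  have hχu : 0 ≤ χ * u := by positivity
  have hexp : 1 / (1 / (s * t) * exp (χ * u)) ^ 2 = (t * s) ^ 2 * exp (-(2 * (χ * u))) := by
    rw [exp_neg, two_mul, exp_add]
    field_simp
  have hq0 := exp_pos (-(2 * (χ * u)))
  have hq1 : exp (-(2 * (χ * u))) ≤ 1 := exp_le_one_iff.2 (by linarith)
  have hq2 := add_one_le_exp (-(2 * (χ * u)))
  rw [hexp]
  set q := exp (-(2 * (χ * u)))
  have key : -((t * s) ^ 2 * q) * (1 / (s * t) ^ 2 + E) + 1 = (1 - q) - (t * s) ^ 2 * q * E := by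
    field_simp
    ring
  have hts2 : (t * s) ^ 2 ≤ 4 := by
    have : 0 < t * s := by positivity
    nlinarith
  have hprod : |(t * s) ^ 2 * q * E| ≤ 4 * 1 * (17 * (M * B * w ^ 2)) := by
    rw [abs_mul, abs_mul, abs_of_pos hq0, abs_of_nonneg (sq_nonneg (t * s))]
    gcongr
  have hχu2 : χ * u ≤ M * B * (4 * w ^ 2) := by
    calc χ * u ≤ 1 * u := by gcongr
      _ ≤ M * (4 * w ^ 2) := by linarith
      _ ≤ M * B * (4 * w ^ 2) := by gcongr; exact le_mul_of_one_le_right hM hB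
  have hfin : 76 * M * B / s ^ 2 = 76 * (M * B * w ^ 2) := by rw [hw]; field_simp
  rw [key, hfin]
  rw [abs_le] at *
  constructor <;> linarith

lemma contDiffAt_logCothHalf {x : ℝ} (hx : 0 < x) : ContDiffAt ℝ (⊤ : ℕ∞) logCothHalf x := by
  have hs := sinh_half_pos hx
  have h2 : ContDiffAt ℝ (⊤ : ℕ∞) (fun y : ℝ => y / 2) x := contDiffAt_id.div_const 2
  exact ((contDiff_cosh.contDiffAt.comp x h2).div (contDiff_sinh.contDiffAt.comp x h2) hs.ne').log
    (div_pos (cosh_pos _) hs).ne'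

lemma contDiffAt_hO {x : ℝ} (hx : 0 < x) : ContDiffAt ℝ (⊤ : ℕ∞) hO x :=
  contDiffAt_const.div (contDiff_sinh.contDiffAt.mul (contDiffAt_logCothHalf hx))
    (mul_pos (sinh_pos_iff.2 hx) (logCothHalf_pos hx)).ne'

lemma contDiffAt_logRatio {c a t : ℝ} (ht : t ≠ 0) (hs : sin (c * (t - a)) ≠ 0) :
    ContDiffAt ℝ (⊤ : ℕ∞) (logRatio c a) t := by
  have h : ContDiffAt ℝ (⊤ : ℕ∞) (fun t : ℝ => c * (t - a)) t := by fun_prop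
  exact ((contDiffAt_id.log ht).add contDiffAt_const).sub
    ((contDiff_sin.contDiffAt.comp t h).log hs)

/-- Logarithmic interpolation between the annulus metric (for `x ≤ ρ₀`) and the metric of the
punctured disc (for `x ≥ ρ₀ + 1`). -/
noncomputable def blend (c a ρ₀ x : ℝ) : ℝ :=
  hO x * exp (smoothTransition (ρ₀ + 1 - x) * logRatio c a (logCothHalf x))

section Blend

variable {c a ρ₀ x : ℝ}

lemma contDiffAt_blend (hc : 0 < c) (hx : 0 < x) (hax : a < logCothHalf x)
    (hxc : c * (logCothHalf x - a) < π) : ContDiffAt ℝ (⊤ : ℕ∞) (blend c a ρ₀) x := by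
  have h1 : ContDiffAt ℝ (⊤ : ℕ∞) (fun x => smoothTransition (ρ₀ + 1 - x)) x :=
    smoothTransition.contDiffAt.comp x (by fun_prop)
  have h2 := (contDiffAt_logRatio (logCothHalf_pos hx).ne' (sin_mul_pos hc hax hxc).ne').comp x
    (contDiffAt_logCothHalf hx)
  exact (contDiffAt_hO hx).mul (h1.mul h2).exp

lemma blend_pos (hx : 0 < x) : 0 < blend c a ρ₀ x := mul_pos (hO_pos hx) (exp_pos _)

lemma hO_le_blend (hc : 0 < c) (ha : 0 ≤ a) (hx : 0 < x) (hax : a < logCothHalf x)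
    (hxc : c * (logCothHalf x - a) < π) : hO x ≤ blend c a ρ₀ x :=
  le_mul_of_one_le_right (hO_pos hx).le <| one_le_exp <|
    mul_nonneg (smoothTransition.nonneg _) (logRatio_nonneg hc ha hax hxc)

lemma blend_le (hc : 0 < c) (ha : 0 ≤ a) (hx : 0 < x) (hax : a < logCothHalf x)
    (hxc : c * (logCothHalf x - a) < π) :
    blend c a ρ₀ x ≤ hO x * exp (logRatio c a (logCothHalf x)) := by
  refine mul_le_mul_of_nonneg_left (exp_le_exp.2 ?_) (hO_pos hx).le
  exact mul_le_of_le_one_left (logRatio_nonneg hc ha hax hxc) (smoothTransition.le_one _)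

lemma blend_of_le (h : x ≤ ρ₀) :
    blend c a ρ₀ x = hO x * exp (logRatio c a (logCothHalf x)) := by
  rw [blend, smoothTransition.one_of_one_le (by linarith), one_mul]

lemma blend_of_ge (h : ρ₀ + 1 ≤ x) : blend c a ρ₀ x = hO x := by
  rw [blend, smoothTransition.zero_of_nonpos (by linarith), zero_mul, exp_zero, mul_one]

lemma eventually_hasDerivAt_logRatio (hc : 0 < c) (hx : 0 < x) (hax : a < logCothHalf x)
    (hxc : c * (logCothHalf x - a) < π) :
    ∀ᶠ t in 𝓝 (logCothHalf x), HasDerivAt (logRatio c a)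
      (1 / t - c * cos (c * (t - a)) / sin (c * (t - a))) t := by
  have h1 : ∀ᶠ t in 𝓝 (logCothHalf x), t ≠ 0 := eventually_ne_nhds (logCothHalf_pos hx).ne'
  have hcont : ContinuousAt (fun t => sin (c * (t - a))) (logCothHalf x) := by fun_prop
  have h2 : ∀ᶠ t in 𝓝 (logCothHalf x), sin (c * (t - a)) ≠ 0 :=
    hcont.eventually_ne (sin_mul_pos hc hax hxc).ne'
  filter_upwards [h1, h2] with t ht hs using hasDerivAt_logRatio ht hs

lemma curvK_blend_of_lt (hc : 0 < c) (hx : 0 < x) (hax : a < logCothHalf x)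
    (hxc : c * (logCothHalf x - a) < π) (h : x < ρ₀) : curvK (blend c a ρ₀) x = -1 := by
  have hs := sinh_pos_iff.2 hx
  have ht := logCothHalf_pos hx
  have hsin := sin_mul_pos hc hax hxc
  have hh : ∀ᶠ y in 𝓝 x, blend c a ρ₀ y =
      hO y * exp ((fun _ => (1 : ℝ)) y * logRatio c a (logCothHalf y)) := by
    filter_upwards [gt_mem_nhds h] with y hy
    rw [blend_of_le (le_of_lt hy), one_mul]
  rw [curvK_blend hx hh (fun y => hasDerivAt_const y (1 : ℝ)) (hasDerivAt_const x (0 : ℝ))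
    (eventually_hasDerivAt_logRatio hc hx hax hxc)
    (hasDerivAt_logRatio_deriv ht.ne' hsin.ne'), blend_of_le h.le, logRatio, exp_sub, exp_add,
    exp_log ht, exp_log hc, exp_log hsin, hO_eq]
  field_simp
  ring

lemma curvK_blend_of_gt (hx : 0 < x) (h : ρ₀ + 1 < x) : curvK (blend c a ρ₀) x = -1 := by
  have hs := sinh_pos_iff.2 hx
  have ht := logCothHalf_pos hx
  have hh : ∀ᶠ y in 𝓝 x, blend c a ρ₀ y = hO y * exp ((fun _ => (0 : ℝ)) y) := by
    filter_upwards [lt_mem_nhds h] with y hy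
    rw [blend_of_ge (le_of_lt hy), exp_zero, mul_one]
  rw [curvK_hO_mul_exp hx hh (.of_forall fun y => hasDerivAt_const y (0 : ℝ))
    (hasDerivAt_const x (0 : ℝ)), blend_of_ge h.le, hO_eq]
  field_simp
  ring

lemma hasDerivAt_smoothTransition (y : ℝ) :
    HasDerivAt smoothTransition (deriv smoothTransition y) y :=
  ((smoothTransition.contDiff (n := 1)).differentiable (by simp) y).hasDerivAt

lemma contDiff_deriv_smoothTransition : ContDiff ℝ 1 (deriv smoothTransition) :=
  ContDiff.iterate_deriv' 1 1 (smoothTransition.contDiff (n := 2))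

lemma exists_bound_deriv_smoothTransition : ∃ B : ℝ, 1 ≤ B ∧ ∀ y ∈ Icc (0 : ℝ) 1,
    |deriv smoothTransition y| ≤ B ∧ |deriv (deriv smoothTransition) y| ≤ B := by
  obtain ⟨B₁, h₁⟩ := isCompact_Icc.exists_bound_of_continuousOn (s := Icc (0 : ℝ) 1)
    contDiff_deriv_smoothTransition.continuous.continuousOn
  obtain ⟨B₂, h₂⟩ := isCompact_Icc.exists_bound_of_continuousOn (s := Icc (0 : ℝ) 1)
    (contDiff_deriv_smoothTransition.continuous_deriv le_rfl).continuousOn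
  refine ⟨max 1 (max B₁ B₂), le_max_left _ _, fun y hy => ⟨?_, ?_⟩⟩
  · exact (h₁ y hy).trans ((le_max_left _ _).trans (le_max_right _ _))
  · exact (h₂ y hy).trans ((le_max_right _ _).trans (le_max_right _ _))

lemma abs_curvK_blend_add_one_le {B : ℝ} (hB : 1 ≤ B) (hBσ : ∀ y ∈ Icc (0 : ℝ) 1,
      |deriv smoothTransition y| ≤ B ∧ |deriv (deriv smoothTransition) y| ≤ B)
    (hc : 0 < c) (hx : 1 ≤ x) (h0 : ρ₀ ≤ x) (h1 : x ≤ ρ₀ + 1) (ha : 0 ≤ a)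
    (ha2 : a ≤ logCothHalf x / 2) (ha3 : a ≤ logCothHalf x ^ 3) (hct : c * logCothHalf x ≤ 1) :
    |curvK (blend c a ρ₀) x + 1| ≤ 76 * (8 + c ^ 2) * B / sinh x ^ 2 := by
  have hx0 : 0 < x := by linarith
  have ht := logCothHalf_pos hx0
  have hax : a < logCothHalf x := by linarith
  have hxc : c * (logCothHalf x - a) < π := by nlinarith [pi_gt_three]
  have hsin := sin_mul_pos hc hax hxc
  have hs1 : 1 ≤ sinh x := hx.trans (self_le_sinh_iff.2 hx0.le)
  have hsub (y : ℝ) : HasDerivAt (fun y => ρ₀ + 1 - y) (-1) y := (hasDerivAt_id y).const_sub _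
  have hχ (y : ℝ) : HasDerivAt (fun y => smoothTransition (ρ₀ + 1 - y))
      (-deriv smoothTransition (ρ₀ + 1 - y)) y :=
    ((hasDerivAt_smoothTransition _).comp y (hsub y)).congr_deriv (by ring)
  have hχ' : HasDerivAt (fun y => -deriv smoothTransition (ρ₀ + 1 - y))
      (deriv (deriv smoothTransition) (ρ₀ + 1 - x)) x :=
    ((contDiff_deriv_smoothTransition.differentiable (by simp) _).hasDerivAt.comp x
      (hsub x)).neg.congr_deriv (by ring)
  obtain ⟨hb1, hb2⟩ := hBσ (ρ₀ + 1 - x) ⟨by linarith, by linarith⟩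
  rw [curvK_blend (h := blend c a ρ₀) hx0 (.of_forall fun y => rfl) hχ hχ'
    (eventually_hasDerivAt_logRatio hc hx0 hax hxc)
    (hasDerivAt_logRatio_deriv ht.ne' hsin.ne'), blend, hO_eq]
  have hM : 2 + c ^ 2 ≤ 8 + c ^ 2 := by linarith
  refine abs_curvature_add_one_le hs1 (cosh_pos x).le ?_ ht (logCothHalf_mul_sinh_le hx0)
    (by positivity) hB (logRatio_nonneg hc ha hax hxc)
    ((logRatio_le hc ht ha ha2 ha3 hct).trans (by gcongr))
    ((abs_deriv_logRatio_le hc ht ha ha2 ha3 hct).trans (by gcongr))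
    (abs_deriv_deriv_logRatio_le hc ht ha ha2 ha3 hct)
    (smoothTransition.nonneg _) (smoothTransition.le_one _) (by rwa [abs_neg]) hb2
  nlinarith [cosh_sq x, cosh_pos x]

end Blend

lemma hR_eq_hO_mul_exp {R₁ R₂ x : ℝ} (hR₁ : 0 < R₁) (hR₂ : R₁ < R₂) (hx : R₁ < tanh (x / 2))
    (hxR : tanh (x / 2) < R₂) :
    hR R₁ R₂ x = hO x * exp (logRatio (π / (-log R₁ - -log R₂)) (-log R₂) (logCothHalf x)) := by
  have hL : log (R₂ / R₁) = -log R₁ - -log R₂ := by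
    rw [log_div (hR₁.trans hR₂).ne' hR₁.ne']; ring
  have hx0 : 0 < x := pos_of_tanh_half_pos (hR₁.trans hx)
  have ht := logCothHalf_pos hx0
  have hs := sinh_pos_iff.2 hx0
  have hl := log_lt_log hR₁ hR₂
  have hlt := log_lt_log (hR₁.trans hx) hxR
  have hlt' := log_lt_log hR₁ hx
  have htanh := logCothHalf_eq_neg_log_tanh x
  have hLp : 0 < -log R₁ - -log R₂ := by linarith
  have hc : 0 < π / (-log R₁ - -log R₂) := div_pos pi_pos hLp
  have hsin := sin_mul_pos (a := -log R₂) (t := logCothHalf x) hc (by linarith) (by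
    rw [div_mul_eq_mul_div, div_lt_iff₀ hLp]
    exact mul_lt_mul_of_pos_left (by linarith) pi_pos)
  have harg : π * (log R₂ - log (tanh (x / 2))) / log (R₂ / R₁) =
      π / (-log R₁ - -log R₂) * (logCothHalf x - -log R₂) := by
    rw [hL, htanh]; ring
  rw [hR, harg, hL, logRatio, exp_sub, exp_add, exp_log ht, exp_log hc, exp_log hsin, hO_eq]
  field_simp

theorem stmt_4 (R₁ : ℝ) (hR₁ : R₁ ∈ Set.Ioo (0 : ℝ) 1) (δ : ℝ) (hδ : δ ∈ Set.Ioo (0 : ℝ) 1) :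
    ∃ ρstar > 0, ∀ ρ₀ ≥ ρstar, ∃ R : ℝ,
      Real.tanh ((ρ₀ + 1) / 2) < R ∧ R < 1 ∧
      ∀ R₂ ∈ Set.Icc R 1, ∃ h : ℝ → ℝ,
        ContDiffOn ℝ (⊤ : ℕ∞) h {ρ : ℝ | R₁ < Real.tanh (ρ / 2) ∧ Real.tanh (ρ / 2) < R₂} ∧
        (∀ ρ ∈ {ρ : ℝ | R₁ < Real.tanh (ρ / 2) ∧ Real.tanh (ρ / 2) < R₂}, 0 < h ρ) ∧
        (∀ ρ ∈ {ρ : ℝ | R₁ < Real.tanh (ρ / 2) ∧ Real.tanh (ρ / 2) < R₂},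
          ρ ≤ ρ₀ → h ρ = hR R₁ R₂ ρ) ∧
        (∀ ρ ∈ {ρ : ℝ | R₁ < Real.tanh (ρ / 2) ∧ Real.tanh (ρ / 2) < R₂},
          ρ₀ + 1 ≤ ρ → h ρ = hO ρ) ∧
        (∀ ρ ∈ {ρ : ℝ | R₁ < Real.tanh (ρ / 2) ∧ Real.tanh (ρ / 2) < R₂},
          hO ρ ≤ h ρ ∧ h ρ ≤ hR R₁ R₂ ρ) ∧
        (∀ ρ ∈ {ρ : ℝ | R₁ < Real.tanh (ρ / 2) ∧ Real.tanh (ρ / 2) < R₂},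
          |curvK h ρ + 1| ≤ δ) := by
  obtain ⟨hR0, hR1⟩ := hR₁
  obtain ⟨hδ0, -⟩ := hδ
  obtain ⟨B, hB, hBσ⟩ := exists_bound_deriv_smoothTransition
  have hT : 0 < -log R₁ := neg_pos.2 (log_neg hR0 hR1)
  have hexpT : R₁ = exp (-(-log R₁)) := by rw [neg_neg, exp_log hR0]
  set T := -log R₁ with hTdef
  set C := 2 * π / T with hC
  have hC0 : 0 < C := by positivity
  have hM0 : 0 ≤ 76 * (8 + C ^ 2) * B / δ := by positivity
  refine ⟨1 + 76 * (8 + C ^ 2) * B / δ + 2 * C, by positivity, fun ρ₀ hρ₀ => ?_⟩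
  have hρ1 : 1 ≤ ρ₀ := by linarith
  have ht1 : 0 < logCothHalf (ρ₀ + 1) := logCothHalf_pos (by linarith)
  set t₁ := logCothHalf (ρ₀ + 1) with ht₁
  obtain ⟨m, hm0, hm1, hm3, hmT⟩ : ∃ m, 0 < m ∧ m ≤ t₁ / 2 ∧ m ≤ t₁ ^ 3 ∧ m ≤ T / 2 :=
    ⟨min (t₁ / 2) (min (t₁ ^ 3) (T / 2)), by positivity, min_le_left _ _,
      (min_le_right _ _).trans (min_le_left _ _), (min_le_right _ _).trans (min_le_right _ _)⟩
  refine ⟨exp (-m), ?_, by rw [exp_lt_one_iff]; linarith, fun R₂ ⟨hmR, hR₂1⟩ => ?_⟩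
  · rw [tanh_half_eq_exp (by linarith)]
    exact exp_lt_exp.2 (by linarith)
  have hR₂0 : 0 < R₂ := (exp_pos _).trans_le hmR
  have hR12 : R₁ < R₂ := by
    refine lt_of_lt_of_le ?_ hmR
    rw [hexpT]
    exact exp_lt_exp.2 (by linarith)
  have hexpa : R₂ = exp (-(-log R₂)) := by rw [neg_neg, exp_log hR₂0]
  have ha0 : 0 ≤ -log R₂ := neg_nonneg.2 (log_nonpos hR₂0.le hR₂1)
  have ham : -log R₂ ≤ m := by
    have := (le_log_iff_exp_le hR₂0).2 hmR
    linarith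
  have hhR := fun x => hR_eq_hO_mul_exp (x := x) hR0 hR12
  rw [← hTdef] at hhR
  set a := -log R₂
  have hL : 0 < T - a := by linarith
  set c := π / (T - a) with hc
  have hc0 : 0 < c := div_pos pi_pos hL
  have hcC : c ≤ C := by
    rw [hc, hC, div_le_div_iff₀ hL hT]
    nlinarith [pi_pos]
  have hI : ∀ x ∈ {ρ : ℝ | R₁ < tanh (ρ / 2) ∧ tanh (ρ / 2) < R₂},
      0 < x ∧ a < logCothHalf x ∧ c * (logCothHalf x - a) < π := by
    rintro x ⟨h1, h2⟩
    have hx : 0 < x := pos_of_tanh_half_pos (hR0.trans h1)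
    rw [tanh_half_eq_exp hx] at h1 h2
    rw [hexpT, exp_lt_exp] at h1
    rw [hexpa, exp_lt_exp] at h2
    refine ⟨hx, by linarith, ?_⟩
    rw [hc, div_mul_eq_mul_div, div_lt_iff₀ hL]
    exact mul_lt_mul_of_pos_left (by linarith) pi_pos
  refine ⟨blend c a ρ₀, ?_, ?_, ?_, ?_, ?_, ?_⟩
  · intro x hx
    obtain ⟨hx0, hax, hxc⟩ := hI x hx
    exact (contDiffAt_blend hc0 hx0 hax hxc).contDiffWithinAt
  · exact fun x hx => blend_pos (hI x hx).1
  · intro x hx hxρ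
    rw [blend_of_le hxρ, hhR x hx.1 hx.2]
  · exact fun x _ hxρ => blend_of_ge hxρ
  · intro x hx
    obtain ⟨hx0, hax, hxc⟩ := hI x hx
    refine ⟨hO_le_blend hc0 ha0 hx0 hax hxc, ?_⟩
    rw [hhR x hx.1 hx.2]
    exact blend_le hc0 ha0 hx0 hax hxc
  · intro x hx
    obtain ⟨hx0, hax, hxc⟩ := hI x hx
    rcases lt_or_ge x ρ₀ with h0 | h0
    · rw [curvK_blend_of_lt hc0 hx0 hax hxc h0]
      simpa using hδ0.le
    rcases lt_or_ge (ρ₀ + 1) x with h1 | h1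
    · rw [curvK_blend_of_gt hx0 h1]
      simpa using hδ0.le
    have hx1 : 1 ≤ x := hρ1.trans h0
    have htx : t₁ ≤ logCothHalf x :=
      logCothHalf_antitoneOn hx0 (show 0 < ρ₀ + 1 by linarith) h1
    have hsx : x ≤ sinh x := self_le_sinh_iff.2 hx0.le
    have hct : c * logCothHalf x ≤ 1 := by
      have h2 := logCothHalf_mul_sinh_le hx0
      have ht := logCothHalf_pos hx0
      have h3 : 2 * c ≤ sinh x := by linarith
      nlinarith
    have ht3 : t₁ ^ 3 ≤ logCothHalf x ^ 3 := by gcongr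
    refine (abs_curvK_blend_add_one_le hB hBσ hc0 hx1 h0 h1 ha0 (by linarith) (by linarith)
      hct).trans ?_
    have hs : 0 < sinh x := by linarith
    rw [div_le_iff₀ (by positivity)]
    have h4 : 76 * (8 + C ^ 2) * B / δ ≤ sinh x ^ 2 := by nlinarith
    rw [div_le_iff₀ hδ0] at h4
    calc 76 * (8 + c ^ 2) * B ≤ 76 * (8 + C ^ 2) * B := by gcongr
      _ ≤ δ * sinh x ^ 2 := by linarith
end

section
/- Let u₁, u₂ : [0,∞) → ℝ be smooth positive functions. If u₂''(ρ)·u₁(ρ) − u₂(ρ)·u₁''(ρ) ≥ 0 for all ρ ≥ 0 and u₂'(0)·u₁(0) − u₂(0)·u₁'(0) ≥ 0, then for any real numbers 0 < w₁ ≤ w₂: (∫₀^{w₁} u₂(ρ)² dρ)/(∫₀^{w₂} u₂(ρ)² dρ) ≤ (∫₀^{w₁} u₁(ρ)² dρ)/(∫₀^{w₂} u₁(ρ)² dρ). -/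
/-- If the Wronskian of `u₁` and `u₂` is nonnegative at `0` and has nonnegative derivative on
`[0, ∞)`, then the ratio `u₂ / u₁` is monotone there. -/
lemma monotoneOn_div_of_wronskian {u₁ u₂ : ℝ → ℝ}
    (hu₁ : ContDiff ℝ 2 u₁) (hu₂ : ContDiff ℝ 2 u₂)
    (hpos₁ : ∀ ρ ≥ (0 : ℝ), 0 < u₁ ρ)
    (hwronsk : ∀ ρ ≥ (0 : ℝ),
      0 ≤ deriv (deriv u₂) ρ * u₁ ρ - u₂ ρ * deriv (deriv u₁) ρ)
    (hinit : 0 ≤ deriv u₂ 0 * u₁ 0 - u₂ 0 * deriv u₁ 0) :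
    MonotoneOn (fun ρ => u₂ ρ / u₁ ρ) (Set.Ici 0) := by
  have h₁ : Differentiable ℝ u₁ := hu₁.differentiable (by norm_num)
  have h₂ : Differentiable ℝ u₂ := hu₂.differentiable (by norm_num)
  have h₁' : Differentiable ℝ (deriv u₁) := hu₁.differentiable_deriv_two
  have h₂' : Differentiable ℝ (deriv u₂) := hu₂.differentiable_deriv_two
  have hW : ∀ x, HasDerivAt (fun ρ => deriv u₂ ρ * u₁ ρ - u₂ ρ * deriv u₁ ρ)
      (deriv (deriv u₂) x * u₁ x - u₂ x * deriv (deriv u₁) x) x := fun x =>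
    (((h₂' x).hasDerivAt.mul (h₁ x).hasDerivAt).sub
      ((h₂ x).hasDerivAt.mul (h₁' x).hasDerivAt)).congr_deriv (by ring)
  have hWmono : MonotoneOn (fun ρ => deriv u₂ ρ * u₁ ρ - u₂ ρ * deriv u₁ ρ) (Set.Ici 0) := by
    refine monotoneOn_of_deriv_nonneg (convex_Ici 0)
      (fun x _ => (hW x).continuousAt.continuousWithinAt)
      (fun x _ => (hW x).differentiableAt.differentiableWithinAt) fun x hx => ?_
    rw [(hW x).deriv]
    exact hwronsk x (interior_subset hx)
  have hr : ∀ x ≥ (0 : ℝ), HasDerivAt (fun ρ => u₂ ρ / u₁ ρ)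
      ((deriv u₂ x * u₁ x - u₂ x * deriv u₁ x) / u₁ x ^ 2) x := fun x hx =>
    (h₂ x).hasDerivAt.div (h₁ x).hasDerivAt (hpos₁ x hx).ne'
  refine monotoneOn_of_deriv_nonneg (convex_Ici 0)
    (fun x hx => (hr x hx).continuousAt.continuousWithinAt)
    (fun x hx => (hr x (interior_subset hx)).differentiableAt.differentiableWithinAt)
    fun x hx => ?_
  have hx0 : (0 : ℝ) ≤ x := interior_subset hx
  rw [(hr x hx0).deriv]
  exact div_nonneg (hinit.trans (hWmono Set.self_mem_Ici hx0 hx0)) (sq_nonneg _)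

theorem stmt_5 (u₁ u₂ : ℝ → ℝ)
    (hu₁ : ContDiff ℝ (⊤ : ℕ∞) u₁) (hu₂ : ContDiff ℝ (⊤ : ℕ∞) u₂)
    (hpos₁ : ∀ ρ ≥ (0 : ℝ), 0 < u₁ ρ) (hpos₂ : ∀ ρ ≥ (0 : ℝ), 0 < u₂ ρ)
    (hwronsk : ∀ ρ ≥ (0 : ℝ),
      0 ≤ deriv (deriv u₂) ρ * u₁ ρ - u₂ ρ * deriv (deriv u₁) ρ)
    (hinit : 0 ≤ deriv u₂ 0 * u₁ 0 - u₂ 0 * deriv u₁ 0)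
    (w₁ w₂ : ℝ) (hw₁ : 0 < w₁) (hw : w₁ ≤ w₂) :
    (∫ ρ in (0 : ℝ)..w₁, (u₂ ρ) ^ 2) / (∫ ρ in (0 : ℝ)..w₂, (u₂ ρ) ^ 2) ≤
    (∫ ρ in (0 : ℝ)..w₁, (u₁ ρ) ^ 2) / (∫ ρ in (0 : ℝ)..w₂, (u₁ ρ) ^ 2) := by
  have hmono := monotoneOn_div_of_wronskian (contDiff_infty.mp hu₁ 2)
    (contDiff_infty.mp hu₂ 2) hpos₁ hwronsk hinit
  have hint₁ : ∀ a b, IntervalIntegrable (fun ρ => u₁ ρ ^ 2) MeasureTheory.volume a b :=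
    fun a b => (hu₁.continuous.pow 2).intervalIntegrable a b
  have hint₂ : ∀ a b, IntervalIntegrable (fun ρ => u₂ ρ ^ 2) MeasureTheory.volume a b :=
    fun a b => (hu₂.continuous.pow 2).intervalIntegrable a b
  obtain ⟨c, hc⟩ : ∃ c, c = (u₂ w₁ / u₁ w₁) ^ 2 := ⟨_, rfl⟩
  have hsq : ∀ x ≥ (0 : ℝ), u₂ x ^ 2 = (u₂ x / u₁ x) ^ 2 * u₁ x ^ 2 := fun x hx => by
    have := (hpos₁ x hx).ne'
    field_simp
  have hA : (∫ ρ in (0 : ℝ)..w₁, u₂ ρ ^ 2) ≤ c * ∫ ρ in (0 : ℝ)..w₁, u₁ ρ ^ 2 := by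
    rw [← intervalIntegral.integral_const_mul]
    refine intervalIntegral.integral_mono_on hw₁.le (hint₂ _ _) ((hint₁ _ _).const_mul c)
      fun x hx => ?_
    rw [hsq x hx.1, hc]
    have := (div_pos (hpos₂ x hx.1) (hpos₁ x hx.1)).le
    have := hmono hx.1 hw₁.le hx.2
    dsimp only at this
    gcongr
  have hB : (c * ∫ ρ in w₁..w₂, u₁ ρ ^ 2) ≤ ∫ ρ in w₁..w₂, u₂ ρ ^ 2 := by
    rw [← intervalIntegral.integral_const_mul]
    refine intervalIntegral.integral_mono_on hw ((hint₁ _ _).const_mul c) (hint₂ _ _)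
      fun x hx => ?_
    have hx0 : 0 ≤ x := hw₁.le.trans hx.1
    rw [hsq x hx0, hc]
    have := (div_pos (hpos₂ w₁ hw₁.le) (hpos₁ w₁ hw₁.le)).le
    have := hmono hw₁.le hx0 hx.1
    dsimp only at this
    gcongr
  have hpos : ∀ u : ℝ → ℝ, (∀ a b, IntervalIntegrable (fun ρ => u ρ ^ 2)
      MeasureTheory.volume a b) → (∀ ρ ≥ (0 : ℝ), 0 < u ρ) → ∀ w > 0,
      0 < ∫ ρ in (0 : ℝ)..w, u ρ ^ 2 := fun u hi hu w hw =>
    intervalIntegral.intervalIntegral_pos_of_pos_on (hi 0 w)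
      (fun x hx => pow_pos (hu x hx.1.le) 2) hw
  have hw₂ := hw₁.trans_le hw
  rw [div_le_div_iff₀ (hpos u₂ hint₂ hpos₂ w₂ hw₂) (hpos u₁ hint₁ hpos₁ w₂ hw₂),
    ← intervalIntegral.integral_add_adjacent_intervals (hint₁ 0 w₁) (hint₁ w₁ w₂),
    ← intervalIntegral.integral_add_adjacent_intervals (hint₂ 0 w₁) (hint₂ w₁ w₂)]
  have hA₁ := hpos u₁ hint₁ hpos₁ w₁ hw₁
  have hB₁ : 0 ≤ ∫ ρ in w₁..w₂, u₁ ρ ^ 2 :=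
    intervalIntegral.integral_nonneg hw fun x _ => sq_nonneg _
  linear_combination mul_le_mul_of_nonneg_right hA hB₁ + mul_le_mul_of_nonneg_left hB hA₁.le
end

section
/- Let δ > 0 and let u : ℝ → ℝ be twice continuously differentiable with u(0) ≥ 0, u(ρ) > 0 for all ρ > 0, u'(0) ≥ 0, and u''(ρ) ≥ δ²·u(ρ) for all ρ ≥ 0. Then for any real numbers 0 < w₁ ≤ w₂: (∫₀^{w₁} u(ρ)² dρ)/(∫₀^{w₂} u(ρ)² dρ) ≤ (4δw₁ + sinh(2δw₁))/(4δw₂ + sinh(2δw₂)). -/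
theorem monotoneOn_div_cosh_of_le_deriv_deriv {δ : ℝ} {u : ℝ → ℝ} (hu : ContDiff ℝ 2 u)
    (h0' : 0 ≤ deriv u 0) (hconv : ∀ ρ ≥ (0 : ℝ), δ ^ 2 * u ρ ≤ deriv (deriv u) ρ) :
    MonotoneOn (fun ρ => u ρ / Real.cosh (δ * ρ)) (Set.Ici 0) := by
  have hd (x : ℝ) : HasDerivAt u (deriv u x) x :=
    (hu.differentiable (by norm_num) x).hasDerivAt
  have hu' : ContDiff ℝ 1 (deriv u) := ContDiff.deriv' hu
  have hdd (x : ℝ) : HasDerivAt (deriv u) (deriv (deriv u) x) x :=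
    (hu'.differentiable (by norm_num) x).hasDerivAt
  have hlin (x : ℝ) : HasDerivAt (fun ρ : ℝ => δ * ρ) δ x := by
    simpa using (hasDerivAt_id x).const_mul δ
  have hW (x : ℝ) : HasDerivAt
      (fun ρ => deriv u ρ * Real.cosh (δ * ρ) - u ρ * (Real.sinh (δ * ρ) * δ))
      ((deriv (deriv u) x - δ ^ 2 * u x) * Real.cosh (δ * x)) x := by
    refine (((hdd x).fun_mul (hlin x).cosh).fun_sub
      ((hd x).fun_mul ((hlin x).sinh.mul_const δ))).congr_deriv ?_
    ring
  have hWmono : MonotoneOn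
      (fun ρ => deriv u ρ * Real.cosh (δ * ρ) - u ρ * (Real.sinh (δ * ρ) * δ))
      (Set.Ici 0) := by
    refine monotoneOn_of_hasDerivWithinAt_nonneg (convex_Ici 0)
      (fun x _ => (hW x).continuousAt.continuousWithinAt)
      (fun x _ => (hW x).hasDerivWithinAt) fun x hx => ?_
    rw [interior_Ici] at hx
    exact mul_nonneg (sub_nonneg.2 (hconv x (le_of_lt hx))) (Real.cosh_pos _).le
  have hq (x : ℝ) := (hd x).fun_div (hlin x).cosh (Real.cosh_pos (δ * x)).ne'
  refine monotoneOn_of_hasDerivWithinAt_nonneg (convex_Ici 0)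
    (fun x _ => (hq x).continuousAt.continuousWithinAt)
    (fun x _ => (hq x).hasDerivWithinAt) fun x hx => ?_
  rw [interior_Ici] at hx
  have hx' : 0 ≤ x := le_of_lt hx
  have hWx := hWmono (Set.mem_Ici.2 le_rfl) (Set.mem_Ici.2 hx') hx'
  simp only [mul_zero, Real.cosh_zero, Real.sinh_zero, mul_one, zero_mul, sub_zero] at hWx
  exact div_nonneg (h0'.trans hWx) (sq_nonneg _)

theorem sq_mul_le_sq_mul_of_mul_le_mul {a b c d : ℝ} (ha : 0 ≤ a) (hc : 0 < c) (hcd : c ≤ d)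
    (h : a * d ≤ b * c) : a ^ 2 * (1 + 2 * d ^ 2) ≤ b ^ 2 * (1 + 2 * c ^ 2) := by
  have hab : a ≤ b :=
    le_of_mul_le_mul_right ((mul_le_mul_of_nonneg_left hcd ha).trans h) hc
  have h₁ : a ^ 2 ≤ b ^ 2 := by gcongr
  have h₂ : (a * d) ^ 2 ≤ (b * c) ^ 2 :=
    pow_le_pow_left₀ (mul_nonneg ha (hc.le.trans hcd)) h 2
  linarith

theorem integral_mul_integral_le_of_mul_le_mul {f g : ℝ → ℝ} (hf : Continuous f)
    (hg : Continuous g) (hg0 : ∀ x, 0 < g x)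
    (hfg : ∀ x y, 0 ≤ x → x ≤ y → f x * g y ≤ f y * g x)
    {a b : ℝ} (ha : 0 ≤ a) (hab : a ≤ b) :
    (∫ x in (0 : ℝ)..a, f x) * (∫ x in (0 : ℝ)..b, g x) ≤
      (∫ x in (0 : ℝ)..a, g x) * ∫ x in (0 : ℝ)..b, f x := by
  have hF := hf.intervalIntegrable (μ := MeasureTheory.volume)
  have hG := hg.intervalIntegrable (μ := MeasureTheory.volume)
  have h₁ : (∫ x in (0 : ℝ)..a, f x) * g a ≤ f a * ∫ x in (0 : ℝ)..a, g x := by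
    rw [← intervalIntegral.integral_mul_const, ← intervalIntegral.integral_const_mul]
    exact intervalIntegral.integral_mono_on ha ((hF 0 a).mul_const _) ((hG 0 a).const_mul _)
      fun x hx => hfg x a hx.1 hx.2
  have h₂ : f a * (∫ x in a..b, g x) ≤ (∫ x in a..b, f x) * g a := by
    rw [← intervalIntegral.integral_mul_const, ← intervalIntegral.integral_const_mul]
    exact intervalIntegral.integral_mono_on hab ((hG a b).const_mul _) ((hF a b).mul_const _)
      fun x hx => hfg a x ha hx.1
  have hG₁ : 0 ≤ ∫ x in (0 : ℝ)..a, g x :=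
    intervalIntegral.integral_nonneg ha fun x _ => (hg0 x).le
  have hG₂ : 0 ≤ ∫ x in a..b, g x :=
    intervalIntegral.integral_nonneg hab fun x _ => (hg0 x).le
  rw [← intervalIntegral.integral_add_adjacent_intervals (hF 0 a) (hF a b),
    ← intervalIntegral.integral_add_adjacent_intervals (hG 0 a) (hG a b)]
  refine le_of_mul_le_mul_right ?_ (hg0 a)
  linarith [mul_le_mul_of_nonneg_right h₁ hG₂, mul_le_mul_of_nonneg_left h₂ hG₁]

theorem integral_mul_one_add_two_mul_cosh_sq (δ w : ℝ) :
    ∫ ρ in (0 : ℝ)..w, 2 * δ * (1 + 2 * Real.cosh (δ * ρ) ^ 2) =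
      4 * δ * w + Real.sinh (2 * δ * w) := by
  have hd (x : ℝ) : HasDerivAt (fun ρ : ℝ => 4 * δ * ρ + Real.sinh (2 * δ * ρ))
      (2 * δ * (1 + 2 * Real.cosh (δ * x) ^ 2)) x := by
    refine (((hasDerivAt_id x).const_mul (4 * δ)).fun_add
      ((hasDerivAt_id x).const_mul (2 * δ)).sinh).congr_deriv ?_
    simp only [id, mul_assoc 2 δ x, Real.cosh_two_mul, Real.sinh_sq]
    ring
  rw [intervalIntegral.integral_eq_sub_of_hasDerivAt (fun x _ => hd x)
    (Continuous.intervalIntegrable (by fun_prop) _ _)]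
  simp

theorem stmt_9 (δ : ℝ) (hδ : 0 < δ) (u : ℝ → ℝ) (hu : ContDiff ℝ 2 u)
    (h0 : 0 ≤ u 0) (hpos : ∀ ρ : ℝ, 0 < ρ → 0 < u ρ) (h0' : 0 ≤ deriv u 0)
    (hconv : ∀ ρ ≥ (0 : ℝ), δ ^ 2 * u ρ ≤ deriv (deriv u) ρ)
    (w₁ w₂ : ℝ) (hw₁ : 0 < w₁) (hw : w₁ ≤ w₂) :
    (∫ ρ in (0 : ℝ)..w₁, (u ρ) ^ 2) / (∫ ρ in (0 : ℝ)..w₂, (u ρ) ^ 2) ≤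
    (4 * δ * w₁ + Real.sinh (2 * δ * w₁)) / (4 * δ * w₂ + Real.sinh (2 * δ * w₂)) := by
  have hw₂ : 0 < w₂ := hw₁.trans_le hw
  have hcont : Continuous fun ρ => u ρ ^ 2 := hu.continuous.pow 2
  have hF : 0 < ∫ ρ in (0 : ℝ)..w₂, (u ρ) ^ 2 :=
    intervalIntegral.intervalIntegral_pos_of_pos_on (hcont.intervalIntegrable 0 w₂)
      (fun x hx => pow_pos (hpos x hx.1) 2) hw₂
  have hG : 0 < 4 * δ * w₂ + Real.sinh (2 * δ * w₂) :=
    add_pos (by positivity) (Real.sinh_pos_iff.2 (by positivity))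
  rw [div_le_div_iff₀ hF hG, ← integral_mul_one_add_two_mul_cosh_sq,
    ← integral_mul_one_add_two_mul_cosh_sq]
  refine integral_mul_integral_le_of_mul_le_mul hcont (by fun_prop) (fun x => by positivity)
    (fun x y hx hxy => ?_) hw₁.le hw
  have hux : 0 ≤ u x := hx.eq_or_lt.elim (fun h => h ▸ h0) fun h => (hpos x h).le
  have hmono := monotoneOn_div_cosh_of_le_deriv_deriv hu h0' hconv
    (Set.mem_Ici.2 hx) (Set.mem_Ici.2 (hx.trans hxy)) hxy
  have hcosh : Real.cosh (δ * x) ≤ Real.cosh (δ * y) := by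
    rw [Real.cosh_le_cosh, abs_of_nonneg (by positivity),
      abs_of_nonneg (mul_nonneg hδ.le (hx.trans hxy))]
    gcongr
  have key := sq_mul_le_sq_mul_of_mul_le_mul hux (Real.cosh_pos _) hcosh
    ((div_le_div_iff₀ (Real.cosh_pos _) (Real.cosh_pos _)).1 hmono)
  linarith [mul_le_mul_of_nonneg_left key (by positivity : 0 ≤ 2 * δ)]
end

section
/- Let u : ℝ → ℝ be twice continuously differentiable with u(0) ≥ 0, u(ρ) > 0 for all ρ > 0, u'(0) ≥ 0, and u''(ρ) ≥ 0 for all ρ ≥ 0. Then for any real numbers 0 < w₁ ≤ w₂: (∫₀^{w₁} u(ρ)² dρ)/(∫₀^{w₂} u(ρ)² dρ) ≤ w₁/w₂. -/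
/-- The mean of a monotone function over `[0, a]` is at most its mean over `[0, b]`
when `0 < a ≤ b`. -/
theorem MonotoneOn.integral_le_div_mul_integral {f : ℝ → ℝ} {a b : ℝ} (ha : 0 < a) (hab : a ≤ b)
    (hf : MonotoneOn f (Set.Icc 0 b)) :
    ∫ x in (0 : ℝ)..a, f x ≤ a / b * ∫ x in (0 : ℝ)..b, f x := by
  have hb : 0 < b := ha.trans_le hab
  have hc : 0 < a / b := div_pos ha hb
  have hc1 : a / b ≤ 1 := (div_le_one hb).2 hab
  have hmem : ∀ x ∈ Set.Icc 0 b, a / b * x ∈ Set.Icc 0 b := fun x hx =>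
    ⟨mul_nonneg hc.le hx.1, (mul_le_of_le_one_left hx.1 hc1).trans hx.2⟩
  have hsub : ∫ x in (0 : ℝ)..a, f x = a / b * ∫ x in (0 : ℝ)..b, f (a / b * x) := by
    rw [intervalIntegral.mul_integral_comp_mul_left, mul_zero, div_mul_cancel₀ a hb.ne']
  have hscaled : MonotoneOn (fun x => f (a / b * x)) (Set.Icc 0 b) := fun x hx y hy hxy =>
    hf (hmem x hx) (hmem y hy) (mul_le_mul_of_nonneg_left hxy hc.le)
  rw [hsub]
  refine mul_le_mul_of_nonneg_left (intervalIntegral.integral_mono_on hb.le ?_ ?_ ?_) hc.le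
  · exact MonotoneOn.intervalIntegrable (by rwa [Set.uIcc_of_le hb.le])
  · exact MonotoneOn.intervalIntegrable (by rwa [Set.uIcc_of_le hb.le])
  · exact fun x hx => hf (hmem x hx) hx (mul_le_of_le_one_left hx.1 hc1)

theorem monotoneOn_Ici_of_deriv2_nonneg {u : ℝ → ℝ} (hu : ContDiff ℝ 2 u)
    (h0' : 0 ≤ deriv u 0) (hconv : ∀ x ≥ (0 : ℝ), 0 ≤ deriv (deriv u) x) :
    MonotoneOn u (Set.Ici 0) := by
  have hu' : ContDiff ℝ 1 (deriv u) := (contDiff_succ_iff_deriv.1 hu).2.2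
  have hmono' : MonotoneOn (deriv u) (Set.Ici 0) :=
    monotoneOn_of_deriv_nonneg (convex_Ici 0) hu'.continuous.continuousOn
      (hu'.differentiable one_ne_zero).differentiableOn
      fun x hx => hconv x (interior_subset hx)
  refine monotoneOn_of_deriv_nonneg (convex_Ici 0) hu.continuous.continuousOn
    (hu.differentiable two_ne_zero).differentiableOn fun x hx => ?_
  have hx0 : x ∈ Set.Ici (0 : ℝ) := interior_subset hx
  exact h0'.trans (hmono' Set.self_mem_Ici hx0 hx0)

theorem stmt_10 (u : ℝ → ℝ) (hu : ContDiff ℝ 2 u)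
    (h0 : 0 ≤ u 0) (hpos : ∀ ρ : ℝ, 0 < ρ → 0 < u ρ) (h0' : 0 ≤ deriv u 0)
    (hconv : ∀ ρ ≥ (0 : ℝ), 0 ≤ deriv (deriv u) ρ)
    (w₁ w₂ : ℝ) (hw₁ : 0 < w₁) (hw : w₁ ≤ w₂) :
    (∫ ρ in (0 : ℝ)..w₁, (u ρ) ^ 2) / (∫ ρ in (0 : ℝ)..w₂, (u ρ) ^ 2) ≤ w₁ / w₂ := by
  have hmono := monotoneOn_Ici_of_deriv2_nonneg hu h0' hconv
  have hsq : MonotoneOn (fun ρ => u ρ ^ 2) (Set.Icc 0 w₂) := fun x hx y hy hxy =>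
    pow_le_pow_left₀ (h0.trans (hmono Set.self_mem_Ici hx.1 hx.1)) (hmono hx.1 hy.1 hxy) 2
  have hint : 0 < ∫ ρ in (0 : ℝ)..w₂, u ρ ^ 2 :=
    intervalIntegral.intervalIntegral_pos_of_pos_on
      ((hu.continuous.pow 2).intervalIntegrable _ _)
      (fun x hx => pow_pos (hpos x hx.1) 2) (hw₁.trans_le hw)
  rw [div_le_iff₀ hint]
  exact hsq.integral_le_div_mul_integral hw₁ hw
end

section
/- For any positive real numbers x and x': max{tanh x'/tanh x, cosh x'/cosh x} ≤ max{1, sinh x'/sinh x} and min{tanh x'/tanh x, cosh x'/cosh x} ≥ min{1, sinh x'/sinh x}. -/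
theorem cosh_mul_sinh_le_sinh_mul_cosh {a b : ℝ} (hab : a ≤ b) :
    Real.cosh b * Real.sinh a ≤ Real.sinh b * Real.cosh a := by
  have h : 0 ≤ Real.sinh (b - a) := Real.sinh_nonneg_iff.2 (sub_nonneg.2 hab)
  rw [Real.sinh_sub] at h
  linarith

theorem tanh_div_tanh (a b : ℝ) :
    Real.tanh b / Real.tanh a =
      (Real.sinh b * Real.cosh a) / (Real.cosh b * Real.sinh a) := by
  rw [Real.tanh_eq_sinh_div_cosh, Real.tanh_eq_sinh_div_cosh, div_div_div_eq]

theorem stmt_11 (x x' : ℝ) (hx : 0 < x) (hx' : 0 < x') :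
    max (Real.tanh x' / Real.tanh x) (Real.cosh x' / Real.cosh x) ≤
      max 1 (Real.sinh x' / Real.sinh x) ∧
    min 1 (Real.sinh x' / Real.sinh x) ≤
      min (Real.tanh x' / Real.tanh x) (Real.cosh x' / Real.cosh x) := by
  have hs : 0 < Real.sinh x := Real.sinh_pos_iff.2 hx
  have hs' : 0 < Real.sinh x' := Real.sinh_pos_iff.2 hx'
  have hc : 0 < Real.cosh x := Real.cosh_pos x
  have hc' : 0 < Real.cosh x' := Real.cosh_pos x'
  have hcs : 0 < Real.cosh x' * Real.sinh x := mul_pos hc' hs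
  rw [tanh_div_tanh]
  rcases le_total x x' with h | h
  · have hcosh : Real.cosh x ≤ Real.cosh x' :=
      Real.cosh_le_cosh.2 (by rwa [abs_of_pos hx, abs_of_pos hx'])
    have hmul := cosh_mul_sinh_le_sinh_mul_cosh h
    refine ⟨le_max_of_le_right (max_le ?_ ?_), min_le_of_left_le (le_min ?_ ?_)⟩
    · rw [div_le_div_iff₀ hcs hs]
      nlinarith [mul_le_mul_of_nonneg_left hcosh (mul_pos hs' hs).le]
    · rwa [div_le_div_iff₀ hc hs]
    · rwa [one_le_div hcs]
    · rwa [one_le_div hc]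
  · have hcosh : Real.cosh x' ≤ Real.cosh x :=
      Real.cosh_le_cosh.2 (by rwa [abs_of_pos hx, abs_of_pos hx'])
    have hmul : Real.sinh x' * Real.cosh x ≤ Real.cosh x' * Real.sinh x := by
      linarith [cosh_mul_sinh_le_sinh_mul_cosh h]
    refine ⟨le_max_of_le_left (max_le ?_ ?_), min_le_of_right_le (le_min ?_ ?_)⟩
    · rwa [div_le_one hcs]
    · rwa [div_le_one hc]
    · rw [div_le_div_iff₀ hs hcs]
      nlinarith [mul_le_mul_of_nonneg_left hcosh (mul_pos hs' hs).le]
    · rwa [div_le_div_iff₀ hs hc]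
end

section
/- Let h, α, b, d, γ be positive real numbers satisfying sinh h = 1/(tanh α · tanh b · tanh d), sinh b · sinh γ ≥ 1, and sinh d · sinh γ ≥ 1. Then sinh h ≤ cosh²γ / tanh α. -/
/-- If `1 ≤ sinh x * sinh y` with `x` positive, then `coth x ≤ cosh y`. -/
theorem one_le_cosh_mul_tanh_of_one_le_sinh_mul_sinh {x y : ℝ} (hx : 0 < x)
    (hxy : 1 ≤ Real.sinh x * Real.sinh y) : 1 ≤ Real.cosh y * Real.tanh x := by
  have hs : 0 < Real.sinh x := Real.sinh_pos_iff.mpr hx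
  rw [Real.tanh_eq_sinh_div_cosh, ← mul_div_assoc, one_le_div (Real.cosh_pos x)]
  refine abs_le_of_sq_le_sq' ?_ (mul_pos (Real.cosh_pos y) hs).le |>.2
  rw [mul_pow, Real.cosh_sq, Real.cosh_sq]
  nlinarith [one_le_pow₀ (n := 2) hxy]

theorem stmt_14 (h α b d γ : ℝ) (hh : 0 < h) (hα : 0 < α) (hb : 0 < b)
    (hd : 0 < d) (hγ : 0 < γ)
    (h1 : Real.sinh h = 1 / (Real.tanh α * Real.tanh b * Real.tanh d))
    (h2 : 1 ≤ Real.sinh b * Real.sinh γ)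
    (h3 : 1 ≤ Real.sinh d * Real.sinh γ) :
    Real.sinh h ≤ (Real.cosh γ) ^ 2 / Real.tanh α := by
  have tanh_pos {x : ℝ} (hx : 0 < x) : 0 < Real.tanh x := by
    rw [Real.tanh_eq_sinh_div_cosh]
    exact div_pos (Real.sinh_pos_iff.mpr hx) (Real.cosh_pos x)
  have hα' := tanh_pos hα
  have hb' := tanh_pos hb
  have hd' := tanh_pos hd
  have key := one_le_mul_of_one_le_of_one_le
    (one_le_cosh_mul_tanh_of_one_le_sinh_mul_sinh hb h2)
    (one_le_cosh_mul_tanh_of_one_le_sinh_mul_sinh hd h3)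
  rw [h1, div_le_div_iff₀ (by positivity) hα']
  nlinarith [mul_le_mul_of_nonneg_left key hα'.le]
end

section
/- Let d, d' be positive real numbers, set δ_d := |sinh d'/sinh d − 1|, and assume δ_d ≤ 1. For u ∈ [0, d], define u' := artanh((tanh d'/tanh d)·tanh u). Then: (1) for all u ∈ [0, d], 1 − δ_d ≤ cosh u'/cosh u ≤ 1 + δ_d and 1 − δ_d ≤ cosh(d'−u')/cosh(d−u) ≤ 1 + δ_d; and (2) for all u ∈ [0, d), 1 − 2δ_d ≤ tanh(d'−u')/tanh(d−u) ≤ 1 + 3δ_d. -/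
/-- The real inverse hyperbolic tangent (not yet in Mathlib):
for `|x| < 1`, `Real.tanh (artanh x) = x`. -/
noncomputable def artanh (x : ℝ) : ℝ := (1 / 2) * Real.log ((1 + x) / (1 - x))

theorem tanh_artanh_of_mem {x : ℝ} (hx : x ∈ Set.Ioo (-1 : ℝ) 1) : Real.tanh (artanh x) = x := by
  have h : artanh x = Real.artanh x :=
    (Real.artanh_eq_half_log (Set.Ioo_subset_Icc_self hx)).symm
  rw [h, Real.tanh_artanh hx]

theorem sinh_eq_of_tanh_eq {d u l : ℝ} (h : Real.tanh u = l * Real.tanh d) :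
    Real.sinh u * Real.cosh d = l * Real.sinh d * Real.cosh u := by
  have hc := Real.cosh_pos d
  have hC := Real.cosh_pos u
  rw [Real.tanh_eq_sinh_div_cosh, Real.tanh_eq_sinh_div_cosh] at h
  field_simp at h
  linarith

theorem cosh_sq_mul_of_tanh_eq {d u l : ℝ} (h : Real.tanh u = l * Real.tanh d) :
    Real.cosh u ^ 2 * (1 + (1 - l ^ 2) * Real.sinh d ^ 2) = 1 + Real.sinh d ^ 2 := by
  have h1 := congrArg (· ^ 2) (sinh_eq_of_tanh_eq h)
  simp only [mul_pow] at h1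
  rw [Real.cosh_sq d, Real.sinh_sq u] at h1
  linear_combination h1

theorem sinh_sub_of_tanh_eq {d u l : ℝ} (h : Real.tanh u = l * Real.tanh d) :
    Real.sinh (d - u) = (1 - l) * Real.sinh d * Real.cosh u := by
  rw [Real.sinh_sub]
  linear_combination -sinh_eq_of_tanh_eq h

theorem cosh_sub_sq_mul_of_tanh_eq {d u l : ℝ} (h : Real.tanh u = l * Real.tanh d) :
    Real.cosh (d - u) ^ 2 * (1 + (1 - l ^ 2) * Real.sinh d ^ 2) =
      (1 + (1 - l) * Real.sinh d ^ 2) ^ 2 := by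
  rw [Real.cosh_sq (d - u), sinh_sub_of_tanh_eq h]
  linear_combination (1 - l) ^ 2 * Real.sinh d ^ 2 * cosh_sq_mul_of_tanh_eq h

theorem mul_le_mul_of_sq_mul_eq {p q x y m n e f : ℝ} (hq : 0 ≤ q) (hy : 0 ≤ y)
    (he : 0 < e) (hf : 0 < f) (hx : x ^ 2 * e = m) (hyn : y ^ 2 * f = n)
    (h : p ^ 2 * m * f ≤ q ^ 2 * n * e) : p * x ≤ q * y := by
  refine le_of_sq_le_sq ?_ (mul_nonneg hq hy)
  subst hx hyn
  have hef := mul_pos he hf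
  refine le_of_mul_le_mul_right ?_ hef
  linarith

/-- If `tanh u / tanh d = tanh v / tanh e`, then the ratios `cosh v / cosh u` and
`cosh (e - v) / cosh (d - u)` lie between `1` and `sinh e / sinh d`. -/
theorem cosh_ratio_bounds {d e u v l : ℝ} (hd : 0 < Real.sinh d)
    (hde : Real.sinh d ≤ Real.sinh e) (hl0 : 0 ≤ l) (hl1 : l ≤ 1)
    (hu : Real.tanh u = l * Real.tanh d) (hv : Real.tanh v = l * Real.tanh e) :
    (Real.cosh u ≤ Real.cosh v ∧
      Real.sinh d * Real.cosh v ≤ Real.sinh e * Real.cosh u) ∧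
    (Real.cosh (d - u) ≤ Real.cosh (e - v) ∧
      Real.sinh d * Real.cosh (e - v) ≤ Real.sinh e * Real.cosh (d - u)) := by
  have hu1 := cosh_sq_mul_of_tanh_eq hu
  have hv1 := cosh_sq_mul_of_tanh_eq hv
  have hu2 := cosh_sub_sq_mul_of_tanh_eq hu
  have hv2 := cosh_sub_sq_mul_of_tanh_eq hv
  have hCu := (Real.cosh_pos u).le
  have hCv := (Real.cosh_pos v).le
  have hKu := (Real.cosh_pos (d - u)).le
  have hKv := (Real.cosh_pos (e - v)).le
  have he : 0 < Real.sinh e := hd.trans_le hde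
  have hS : Real.sinh d ^ 2 ≤ Real.sinh e ^ 2 := by gcongr
  have hS0 := sq_nonneg (Real.sinh d)
  have hT0 := sq_nonneg (Real.sinh e)
  set S := Real.sinh d ^ 2 with hSdef
  set T := Real.sinh e ^ 2 with hTdef
  have ha : 0 ≤ 1 - l := by linarith
  have hb : 0 ≤ 1 - l ^ 2 := by nlinarith
  have hab : 0 ≤ 2 * (1 - l) - (1 - l ^ 2) := by nlinarith
  have hba : 0 ≤ 2 * (1 - l) * (1 - l ^ 2) - (1 - l) ^ 2 := by
    have : 0 ≤ (1 - l) ^ 2 * (1 + 2 * l) := by positivity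
    linarith
  have hTS : 0 ≤ T - S := by linarith
  have hE : 0 < 1 + (1 - l ^ 2) * S := by positivity
  have hF : 0 < 1 + (1 - l ^ 2) * T := by positivity
  have h1 : 0 ≤ l ^ 2 * (T - S) := by positivity
  have h2 : 0 ≤ (T - S) * (1 + (1 - l ^ 2) * (S + T + S * T)) := by positivity
  have h3 : 0 ≤ (T - S) * ((2 * (1 - l) - (1 - l ^ 2)) + (1 - l) ^ 2 * (S + T)
      + (1 - l) ^ 2 * (1 - l ^ 2) * (S * T)) := by positivity
  have h4 : 0 ≤ (T - S) * (1 + (1 - l ^ 2) * (S + T)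
      + (2 * (1 - l) * (1 - l ^ 2) - (1 - l) ^ 2) * (S * T)) := by positivity
  refine ⟨⟨?_, ?_⟩, ?_, ?_⟩
  · simpa using mul_le_mul_of_sq_mul_eq (p := 1) zero_le_one hCv hE hF hu1 hv1 (by linarith)
  · exact mul_le_mul_of_sq_mul_eq he.le hCu hF hE hv1 hu1 (by
      rw [← hSdef, ← hTdef]; linarith)
  · simpa using mul_le_mul_of_sq_mul_eq (p := 1) zero_le_one hKv hE hF hu2 hv2 (by linarith)
  · exact mul_le_mul_of_sq_mul_eq he.le hKu hF hE hv2 hu2 (by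
      rw [← hSdef, ← hTdef]; linarith)

theorem cosh_ratio_cases {d e u v l : ℝ} (hd : 0 < Real.sinh d) (he : 0 < Real.sinh e)
    (hl0 : 0 ≤ l) (hl1 : l ≤ 1)
    (hu : Real.tanh u = l * Real.tanh d) (hv : Real.tanh v = l * Real.tanh e) :
    (1 ≤ Real.cosh v / Real.cosh u ∧ Real.cosh v / Real.cosh u ≤ Real.sinh e / Real.sinh d ∧
      1 ≤ Real.cosh (e - v) / Real.cosh (d - u) ∧
      Real.cosh (e - v) / Real.cosh (d - u) ≤ Real.sinh e / Real.sinh d) ∨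
    (Real.cosh v / Real.cosh u ≤ 1 ∧ Real.sinh e / Real.sinh d ≤ Real.cosh v / Real.cosh u ∧
      Real.cosh (e - v) / Real.cosh (d - u) ≤ 1 ∧
      Real.sinh e / Real.sinh d ≤ Real.cosh (e - v) / Real.cosh (d - u)) := by
  have hCu := Real.cosh_pos u
  have hKu := Real.cosh_pos (d - u)
  rcases le_total (Real.sinh d) (Real.sinh e) with h | h
  · left
    obtain ⟨⟨h1, h2⟩, h3, h4⟩ := cosh_ratio_bounds hd h hl0 hl1 hu hv
    rw [one_le_div hCu, one_le_div hKu, div_le_div_iff₀ hCu hd, div_le_div_iff₀ hKu hd]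
    exact ⟨h1, by linarith, h3, by linarith⟩
  · right
    obtain ⟨⟨h1, h2⟩, h3, h4⟩ := cosh_ratio_bounds he h hl0 hl1 hv hu
    rw [div_le_one hCu, div_le_one hKu, div_le_div_iff₀ hd hCu, div_le_div_iff₀ hd hKu]
    exact ⟨h1, by linarith, h3, by linarith⟩

theorem tanh_sub_ratio {d e u v l : ℝ} (hd : Real.sinh d ≠ 0) (hl : l ≠ 1)
    (hu : Real.tanh u = l * Real.tanh d) (hv : Real.tanh v = l * Real.tanh e) :
    Real.tanh (e - v) / Real.tanh (d - u) =
      Real.cosh v / Real.cosh u * (Real.sinh e / Real.sinh d) /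
        (Real.cosh (e - v) / Real.cosh (d - u)) := by
  have hl' : 1 - l ≠ 0 := sub_ne_zero.2 hl.symm
  have hCu := (Real.cosh_pos u).ne'
  have hKu := (Real.cosh_pos (d - u)).ne'
  have hKv := (Real.cosh_pos (e - v)).ne'
  rw [Real.tanh_eq_sinh_div_cosh, Real.tanh_eq_sinh_div_cosh, sinh_sub_of_tanh_eq hu,
    sinh_sub_of_tanh_eq hv]
  field_simp

theorem tanh_lt_tanh_of_lt {x y : ℝ} (h : x < y) : Real.tanh x < Real.tanh y := by
  have h1 : 0 < Real.sinh (y - x) := Real.sinh_pos_iff.2 (sub_pos.2 h)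
  rw [Real.sinh_sub] at h1
  rw [Real.tanh_eq_sinh_div_cosh, Real.tanh_eq_sinh_div_cosh,
    div_lt_div_iff₀ (Real.cosh_pos x) (Real.cosh_pos y)]
  linarith

theorem stmt_16 (d d' : ℝ) (hd : 0 < d) (hd' : 0 < d')
    (hδ : |Real.sinh d' / Real.sinh d - 1| ≤ 1) :
    (∀ u ∈ Set.Icc (0 : ℝ) d,
      (1 - |Real.sinh d' / Real.sinh d - 1| ≤
          Real.cosh (artanh (Real.tanh d' / Real.tanh d * Real.tanh u)) / Real.cosh u ∧
        Real.cosh (artanh (Real.tanh d' / Real.tanh d * Real.tanh u)) / Real.cosh u ≤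
          1 + |Real.sinh d' / Real.sinh d - 1|) ∧
      (1 - |Real.sinh d' / Real.sinh d - 1| ≤
          Real.cosh (d' - artanh (Real.tanh d' / Real.tanh d * Real.tanh u)) /
            Real.cosh (d - u) ∧
        Real.cosh (d' - artanh (Real.tanh d' / Real.tanh d * Real.tanh u)) /
            Real.cosh (d - u) ≤
          1 + |Real.sinh d' / Real.sinh d - 1|)) ∧
    (∀ u ∈ Set.Ico (0 : ℝ) d,
      1 - 2 * |Real.sinh d' / Real.sinh d - 1| ≤
          Real.tanh (d' - artanh (Real.tanh d' / Real.tanh d * Real.tanh u)) /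
            Real.tanh (d - u) ∧
        Real.tanh (d' - artanh (Real.tanh d' / Real.tanh d * Real.tanh u)) /
            Real.tanh (d - u) ≤
          1 + 3 * |Real.sinh d' / Real.sinh d - 1|) := by
  have hs : 0 < Real.sinh d := Real.sinh_pos_iff.2 hd
  have hs' : 0 < Real.sinh d' := Real.sinh_pos_iff.2 hd'
  have hT : 0 < Real.tanh d := by
    rw [Real.tanh_eq_sinh_div_cosh]; exact div_pos hs (Real.cosh_pos d)
  have hT' : 0 < Real.tanh d' := by
    rw [Real.tanh_eq_sinh_div_cosh]; exact div_pos hs' (Real.cosh_pos d')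
  have key : ∀ u ∈ Set.Icc (0 : ℝ) d, ∃ l, 0 ≤ l ∧ l ≤ 1 ∧ Real.tanh u = l * Real.tanh d ∧
      Real.tanh (artanh (Real.tanh d' / Real.tanh d * Real.tanh u)) = l * Real.tanh d' := by
    intro u hu
    have hu0 : 0 ≤ Real.tanh u := by
      rw [Real.tanh_eq_sinh_div_cosh]
      exact div_nonneg (Real.sinh_nonneg_iff.2 hu.1) (Real.cosh_pos u).le
    have hud : Real.tanh u ≤ Real.tanh d :=
      hu.2.eq_or_lt.elim (fun h => h ▸ le_rfl) (fun h => (tanh_lt_tanh_of_lt h).le)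
    have hl1 : Real.tanh u / Real.tanh d ≤ 1 := (div_le_one hT).2 hud
    have hl0 : 0 ≤ Real.tanh u / Real.tanh d := by positivity
    refine ⟨Real.tanh u / Real.tanh d, hl0, hl1, by field_simp, ?_⟩
    have heq : Real.tanh d' / Real.tanh d * Real.tanh u =
        Real.tanh u / Real.tanh d * Real.tanh d' := by ring
    have hlt := Real.tanh_lt_one d'
    have hle : Real.tanh u / Real.tanh d * Real.tanh d' ≤ 1 * Real.tanh d' := by gcongr
    rw [heq]
    refine tanh_artanh_of_mem ⟨?_, by linarith⟩
    have : 0 ≤ Real.tanh u / Real.tanh d * Real.tanh d' := by positivity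
    linarith
  have hδ' := (abs_le.1 hδ).2
  constructor
  · intro u hu
    obtain ⟨l, hl0, hl1, h1, h2⟩ := key u hu
    have h3 := neg_abs_le (Real.sinh d' / Real.sinh d - 1)
    have h4 := le_abs_self (Real.sinh d' / Real.sinh d - 1)
    have h5 := abs_nonneg (Real.sinh d' / Real.sinh d - 1)
    rcases cosh_ratio_cases hs hs' hl0 hl1 h1 h2 with ⟨p1, p2, q1, q2⟩ | ⟨p1, p2, q1, q2⟩
    · exact ⟨⟨by linarith, by linarith⟩, by linarith, by linarith⟩
    · exact ⟨⟨by linarith, by linarith⟩, by linarith, by linarith⟩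
  · intro u hu
    obtain ⟨l, hl0, hl1, h1, h2⟩ := key u (Set.Ico_subset_Icc_self hu)
    have hl : l ≠ 1 := by
      rintro rfl
      have := tanh_lt_tanh_of_lt hu.2
      linarith
    rw [tanh_sub_ratio hs.ne' hl h1 h2]
    have hP := div_pos (Real.cosh_pos (artanh (Real.tanh d' / Real.tanh d * Real.tanh u)))
      (Real.cosh_pos u)
    have hQ := div_pos (Real.cosh_pos (d' - artanh (Real.tanh d' / Real.tanh d * Real.tanh u)))
      (Real.cosh_pos (d - u))
    have hr := div_pos hs' hs
    have hc := cosh_ratio_cases hs hs' hl0 hl1 h1 h2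
    generalize Real.cosh (artanh (Real.tanh d' / Real.tanh d * Real.tanh u)) / Real.cosh u = P
      at hc hP ⊢
    generalize Real.cosh (d' - artanh (Real.tanh d' / Real.tanh d * Real.tanh u)) /
      Real.cosh (d - u) = Q at hc hQ ⊢
    generalize Real.sinh d' / Real.sinh d = r at hc hr hδ' ⊢
    rw [le_div_iff₀ hQ, div_le_iff₀ hQ]
    rcases hc with ⟨p1, p2, q1, q2⟩ | ⟨p1, p2, q1, q2⟩
    · rw [abs_of_nonneg (by linarith)]
      have hlow : 1 * Q ≤ P * r := mul_le_mul p1 q2 hQ.le hP.le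
      have hup : P * r ≤ r * r := mul_le_mul_of_nonneg_right p2 hr.le
      have hrr : r * r ≤ 1 + 3 * (r - 1) := by nlinarith
      exact ⟨by nlinarith, by nlinarith⟩
    · rw [abs_of_nonpos (by linarith)]
      have hlow : r * r ≤ P * r := mul_le_mul_of_nonneg_right p2 hr.le
      have hup : P * r ≤ 1 * Q := mul_le_mul p1 q2 hr.le zero_le_one
      have hQr : r * r * Q ≤ r * r := mul_le_of_le_one_right (by positivity) q1
      have hrr : 1 - 2 * -(r - 1) ≤ r * r := by nlinarith [sq_nonneg (r - 1)]
      exact ⟨by nlinarith, by nlinarith⟩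
end

section
/- Let α, d, d' be positive real numbers, set δ_d := |sinh d'/sinh d − 1|, and assume δ_d ≤ 1/2. Let c, c', γ, γ' be positive reals satisfying sinh²c = 1/sinh²d + 1/(sinh²α · tanh²d), sinh²c' = 1/sinh²d' + 1/(sinh²α · tanh²d'), sinh γ = cosh α / sinh d, and sinh γ' = cosh α / sinh d'. Then 1 − δ_d ≤ sinh c'/sinh c ≤ 1 + 2δ_d and 1 − δ_d ≤ sinh γ'/sinh γ ≤ 1 + 2δ_d. -/
/-- Comparison of positive square roots of `K * x ^ 2 + L` and `K * y ^ 2 + L`. -/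
theorem mul_le_mul_of_sq_eq_mul_sq_add {K L k l x y C D : ℝ} (hK : 0 ≤ K) (hL : 0 ≤ L)
    (hl : 0 ≤ l) (hlk : l ≤ k) (hx : 0 ≤ x) (hxy : l * x ≤ k * y) (hD : 0 ≤ D)
    (hCx : C ^ 2 = K * x ^ 2 + L) (hDy : D ^ 2 = K * y ^ 2 + L) : l * C ≤ k * D := by
  refine le_of_sq_le_sq ?_ (mul_nonneg (hl.trans hlk) hD)
  have h₁ : K * (l * x) ^ 2 ≤ K * (k * y) ^ 2 := by gcongr
  have h₂ : L * l ^ 2 ≤ L * k ^ 2 := by gcongr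
  rw [mul_pow, mul_pow, hCx, hDy]
  linarith

/-- The squared side of a right-angled pentagon is affine in `(1 / sinh d) ^ 2`. -/
theorem pentagon_sinh_sq_eq {a d : ℝ} (ha : 0 < a) (hd : 0 < d) :
    1 / Real.sinh d ^ 2 + 1 / (a ^ 2 * Real.tanh d ^ 2) =
      (1 + 1 / a ^ 2) * (1 / Real.sinh d) ^ 2 + 1 / a ^ 2 := by
  have hs := Real.sinh_pos_iff.2 hd
  have hc := Real.cosh_pos d
  rw [Real.tanh_eq_sinh_div_cosh]
  field_simp
  rw [Real.cosh_sq]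
  ring

theorem stmt_17 (α d d' c c' γ γ' : ℝ)
    (hα : 0 < α) (hd : 0 < d) (hd' : 0 < d')
    (hc : 0 < c) (hc' : 0 < c') (hγ : 0 < γ) (hγ' : 0 < γ')
    (hδ : |Real.sinh d' / Real.sinh d - 1| ≤ 1 / 2)
    (hcdef : (Real.sinh c) ^ 2 =
      1 / (Real.sinh d) ^ 2 + 1 / ((Real.sinh α) ^ 2 * (Real.tanh d) ^ 2))
    (hcdef' : (Real.sinh c') ^ 2 =
      1 / (Real.sinh d') ^ 2 + 1 / ((Real.sinh α) ^ 2 * (Real.tanh d') ^ 2))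
    (hγdef : Real.sinh γ = Real.cosh α / Real.sinh d)
    (hγdef' : Real.sinh γ' = Real.cosh α / Real.sinh d') :
    (1 - |Real.sinh d' / Real.sinh d - 1| ≤ Real.sinh c' / Real.sinh c ∧
      Real.sinh c' / Real.sinh c ≤ 1 + 2 * |Real.sinh d' / Real.sinh d - 1|) ∧
    (1 - |Real.sinh d' / Real.sinh d - 1| ≤ Real.sinh γ' / Real.sinh γ ∧
      Real.sinh γ' / Real.sinh γ ≤ 1 + 2 * |Real.sinh d' / Real.sinh d - 1|) := by
  have hs := Real.sinh_pos_iff.2 hd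
  have hs' := Real.sinh_pos_iff.2 hd'
  have hA := Real.sinh_pos_iff.2 hα
  have hC := Real.sinh_pos_iff.2 hc
  have hC' := Real.sinh_pos_iff.2 hc'
  have hΓ := Real.sinh_pos_iff.2 hγ
  rw [pentagon_sinh_sq_eq hA hd] at hcdef
  rw [pentagon_sinh_sq_eq hA hd'] at hcdef'
  set t := |Real.sinh d' / Real.sinh d - 1| with ht
  have ht0 : 0 ≤ t := abs_nonneg _
  obtain ⟨h₁, h₂⟩ := abs_le.1 ht.ge
  have hr : Real.sinh d' = Real.sinh d' / Real.sinh d * Real.sinh d := by field_simp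
  have hlow : (1 - t) * Real.sinh d' ≤ Real.sinh d := by
    rw [hr]
    have : (1 - t) * (Real.sinh d' / Real.sinh d) ≤ 1 := by nlinarith
    nlinarith
  have hupp : Real.sinh d ≤ (1 + 2 * t) * Real.sinh d' := by
    rw [hr]
    have : 1 ≤ (1 + 2 * t) * (Real.sinh d' / Real.sinh d) := by nlinarith
    nlinarith
  have hlow' : (1 - t) * (1 / Real.sinh d) ≤ 1 * (1 / Real.sinh d') := by
    rw [mul_one_div, mul_one_div, div_le_div_iff₀ hs hs']
    linarith
  have hupp' : 1 * (1 / Real.sinh d') ≤ (1 + 2 * t) * (1 / Real.sinh d) := by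
    rw [mul_one_div, mul_one_div, div_le_div_iff₀ hs' hs]
    linarith
  have hK : 0 ≤ 1 + 1 / Real.sinh α ^ 2 := by positivity
  have hL : 0 ≤ 1 / Real.sinh α ^ 2 := by positivity
  have hcosh := Real.cosh_pos α
  rw [le_div_iff₀ hC, div_le_iff₀ hC, le_div_iff₀ hΓ, div_le_iff₀ hΓ, hγdef, hγdef']
  refine ⟨⟨?_, ?_⟩, ?_, ?_⟩
  · simpa only [one_mul] using mul_le_mul_of_sq_eq_mul_sq_add hK hL
      (by linarith) (by linarith) (by positivity) hlow' hC'.le hcdef hcdef'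
  · simpa only [one_mul] using mul_le_mul_of_sq_eq_mul_sq_add hK hL
      zero_le_one (by linarith) (by positivity) hupp' hC.le hcdef' hcdef
  · rw [← mul_div_assoc, div_le_div_iff₀ hs hs']
    nlinarith
  · rw [← mul_div_assoc, div_le_div_iff₀ hs' hs]
    nlinarith
end

section
/- Let d, d' be positive real numbers, set δ_d := |sinh d'/sinh d − 1|, and assume δ_d ≤ 1/15. For u ∈ [0, d], define u' := artanh((tanh d'/tanh d)·tanh u). Then for all u ∈ [0, d]: 1 − (100/9)·δ_d ≤ ((tanh d'/tanh d)·(cosh²u'/cosh²u))² ≤ 1 + (100/9)·δ_d. -/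
theorem cosh_artanh_sq {x : ℝ} (hx : x ∈ Set.Ioo (-1 : ℝ) 1) :
    Real.cosh (artanh x) ^ 2 = 1 / (1 - x ^ 2) := by
  have h : artanh x = Real.artanh x :=
    (Real.artanh_eq_half_log ⟨hx.1.le, hx.2.le⟩).symm
  have h0 : 0 ≤ 1 - x ^ 2 := by nlinarith [hx.1, hx.2]
  rw [h, Real.cosh_artanh hx, div_pow, one_pow, Real.sq_sqrt h0]

/-- An inequality affine in `t` that holds at `0` and at `b > 0` holds on `[0, b]`. -/
theorem affine_nonneg_of_endpoints {p q b t : ℝ} (hb : 0 < b) (ht : 0 ≤ t) (htb : t ≤ b)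
    (h0 : 0 ≤ p) (h1 : 0 ≤ p + q * b) : 0 ≤ p + q * t := by
  have h : 0 ≤ b * (p + q * t) := by
    nlinarith [mul_nonneg h0 (sub_nonneg.2 htb), mul_nonneg h1 ht]
  exact nonneg_of_mul_nonneg_right h hb

theorem tanh_pos_of_pos {x : ℝ} (hx : 0 < x) : 0 < Real.tanh x := by
  rw [Real.tanh_eq_sinh_div_cosh]
  exact div_pos (Real.sinh_pos_iff.2 hx) (Real.cosh_pos x)

theorem tanh_nonneg_of_nonneg {x : ℝ} (hx : 0 ≤ x) : 0 ≤ Real.tanh x := by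
  rw [Real.tanh_eq_sinh_div_cosh]
  exact div_nonneg (Real.sinh_nonneg_iff.2 hx) (Real.cosh_pos x).le

theorem tanh_le_tanh_of_le {x y : ℝ} (h : x ≤ y) : Real.tanh x ≤ Real.tanh y := by
  rw [Real.tanh_eq_sinh_div_cosh, Real.tanh_eq_sinh_div_cosh,
    div_le_div_iff₀ (Real.cosh_pos x) (Real.cosh_pos y)]
  have := Real.sinh_nonneg_iff.2 (sub_nonneg.2 h)
  rw [Real.sinh_sub] at this
  linarith

/-- With `k = sinh d' / sinh d`, the factor relating the hyperbolic tangents is between `1`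
and `k`, and the endpoint value `a * cosh d' ^ 2 / cosh d ^ 2` is between `k` and `k ^ 2`. -/
theorem tanh_ratio_bounds {d d' : ℝ} (hd : 0 < d) (hd' : 0 < d') :
    let k := Real.sinh d' / Real.sinh d
    let a := Real.tanh d' / Real.tanh d
    let b := Real.tanh d ^ 2
    (1 ≤ k → 1 ≤ a ∧ a ≤ k ∧ a * (1 - b) ≤ k ^ 2 * (1 - a ^ 2 * b)) ∧
      (k ≤ 1 → a ≤ 1 ∧ k ≤ a ∧ k ^ 2 * (1 - a ^ 2 * b) ≤ a * (1 - b)) := by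
  intro k a b
  have hs : 0 < Real.sinh d := Real.sinh_pos_iff.2 hd
  have hs' : 0 < Real.sinh d' := Real.sinh_pos_iff.2 hd'
  have hc := Real.cosh_pos d
  have hc' := Real.cosh_pos d'
  have e := Real.cosh_sq d
  have e' := Real.cosh_sq d'
  have hk : 0 < k := div_pos hs' hs
  have hks : Real.sinh d' = k * Real.sinh d := by simp only [k]; field_simp
  have ha : a = k * (Real.cosh d / Real.cosh d') := by
    simp only [a, k, Real.tanh_eq_sinh_div_cosh]; field_simp
  have hb : 1 - b = 1 / Real.cosh d ^ 2 := by
    simp only [b, Real.tanh_eq_sinh_div_cosh]; field_simp; linarith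
  have hab : 1 - a ^ 2 * b = 1 / Real.cosh d' ^ 2 := by
    simp only [a, b, Real.tanh_eq_sinh_div_cosh]; field_simp; linarith
  have hl : a * (1 - b) = k / (Real.cosh d * Real.cosh d') := by
    rw [hb, ha]; field_simp
  have hr : k ^ 2 * (1 - a ^ 2 * b) =
      k * (k * Real.cosh d / Real.cosh d') / (Real.cosh d * Real.cosh d') := by
    rw [hab]; field_simp
  rw [hks] at e'
  have ha' : a = k * Real.cosh d / Real.cosh d' := by rw [ha]; ring
  rw [hl, hr, ← ha']
  constructor
  · intro h
    have h1 : Real.cosh d ≤ Real.cosh d' := by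
      refine le_of_abs_le (abs_le_of_sq_le_sq ?_ hc'.le)
      nlinarith [mul_nonneg (sub_nonneg.2 (one_le_pow₀ h : 1 ≤ k ^ 2)) (sq_nonneg (Real.sinh d))]
    have h2 : Real.cosh d' ≤ k * Real.cosh d := by
      refine le_of_abs_le (abs_le_of_sq_le_sq ?_ (by positivity))
      nlinarith [one_le_pow₀ h (n := 2)]
    have h3 : 1 ≤ a := by rw [ha', one_le_div hc']; exact h2
    refine ⟨h3, ?_, ?_⟩
    · rw [ha]; exact mul_le_of_le_one_right hk.le ((div_le_one hc').2 h1)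
    · gcongr; exact le_mul_of_one_le_right hk.le h3
  · intro h
    have h0 : k ^ 2 ≤ 1 := pow_le_one₀ hk.le h
    have h1 : Real.cosh d' ≤ Real.cosh d := by
      refine le_of_abs_le (abs_le_of_sq_le_sq ?_ hc.le)
      nlinarith [mul_nonneg (sub_nonneg.2 h0) (sq_nonneg (Real.sinh d))]
    have h2 : k * Real.cosh d ≤ Real.cosh d' := by
      refine le_of_abs_le (abs_le_of_sq_le_sq ?_ hc'.le)
      nlinarith
    have h3 : a ≤ 1 := by rw [ha', div_le_one hc']; exact h2
    refine ⟨h3, ?_, ?_⟩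
    · rw [ha]; exact le_mul_of_one_le_right hk.le ((one_le_div hc').2 h1)
    · gcongr; exact mul_le_of_le_one_right hk.le h3

theorem stmt_18 (d d' : ℝ) (hd : 0 < d) (hd' : 0 < d')
    (hδ : |Real.sinh d' / Real.sinh d - 1| ≤ 1 / 15) :
    ∀ u ∈ Set.Icc (0 : ℝ) d,
      1 - (100 / 9) * |Real.sinh d' / Real.sinh d - 1| ≤
        ((Real.tanh d' / Real.tanh d) *
          ((Real.cosh (artanh (Real.tanh d' / Real.tanh d * Real.tanh u))) ^ 2 /
            (Real.cosh u) ^ 2)) ^ 2 ∧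
      ((Real.tanh d' / Real.tanh d) *
          ((Real.cosh (artanh (Real.tanh d' / Real.tanh d * Real.tanh u))) ^ 2 /
            (Real.cosh u) ^ 2)) ^ 2 ≤
        1 + (100 / 9) * |Real.sinh d' / Real.sinh d - 1| := by
  intro u hu
  have hk : 0 < Real.sinh d' / Real.sinh d :=
    div_pos (Real.sinh_pos_iff.2 hd') (Real.sinh_pos_iff.2 hd)
  have htd : 0 < Real.tanh d := tanh_pos_of_pos hd
  have htd' : 0 < Real.tanh d' := tanh_pos_of_pos hd'
  have htu : 0 ≤ Real.tanh u := tanh_nonneg_of_nonneg hu.1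
  have htud : Real.tanh u ≤ Real.tanh d := tanh_le_tanh_of_le hu.2
  obtain ⟨hge, hle⟩ := tanh_ratio_bounds hd hd'
  have ha : 0 < Real.tanh d' / Real.tanh d := div_pos htd' htd
  have hx0 : 0 ≤ Real.tanh d' / Real.tanh d * Real.tanh u := mul_nonneg ha.le htu
  have hx1 : Real.tanh d' / Real.tanh d * Real.tanh u < 1 :=
    calc Real.tanh d' / Real.tanh d * Real.tanh u
        ≤ Real.tanh d' / Real.tanh d * Real.tanh d := by gcongr
      _ = Real.tanh d' := by field_simp
      _ < 1 := Real.tanh_lt_one d'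
  rw [cosh_artanh_sq ⟨by linarith, hx1⟩]
  have hcu : 1 / Real.cosh u ^ 2 = 1 - Real.tanh u ^ 2 := by
    have := Real.cosh_pos u
    rw [Real.tanh_eq_sinh_div_cosh]; field_simp; linarith [Real.cosh_sq u]
  have hden : 0 < 1 - (Real.tanh d' / Real.tanh d) ^ 2 * Real.tanh u ^ 2 := by nlinarith
  rw [div_eq_mul_one_div (1 / _) (Real.cosh u ^ 2), hcu, mul_pow (_ / _) (Real.tanh u)]
  have hb : 0 < Real.tanh d ^ 2 := by positivity
  have ht : 0 ≤ Real.tanh u ^ 2 := by positivity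
  have htb : Real.tanh u ^ 2 ≤ Real.tanh d ^ 2 := by gcongr
  generalize Real.tanh d ^ 2 = b at *
  generalize Real.tanh u ^ 2 = t at *
  generalize Real.tanh d' / Real.tanh d = a at *
  generalize Real.sinh d' / Real.sinh d = k at *
  have hQ : a * (1 / (1 - a ^ 2 * t) * (1 - t)) = a * (1 - t) / (1 - a ^ 2 * t) := by ring
  rw [hQ]
  obtain ⟨hδ1, hδ2⟩ := abs_le.1 hδ
  rcases le_total 1 k with h | h
  · obtain ⟨h1, h2, h3⟩ := hge h
    rw [abs_of_nonneg (by linarith)]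
    have hlow : 1 ≤ a * (1 - t) / (1 - a ^ 2 * t) := by
      rw [one_le_div hden]
      nlinarith [mul_nonneg (sub_nonneg.2 h1) (by positivity : 0 ≤ 1 + a * t)]
    have hupp : a * (1 - t) / (1 - a ^ 2 * t) ≤ k ^ 2 := by
      rw [div_le_iff₀ hden]
      have := affine_nonneg_of_endpoints (p := k ^ 2 - a) (q := a - k ^ 2 * a ^ 2) hb ht htb
        (by nlinarith) (by linarith)
      linarith
    constructor
    · linarith [one_le_pow₀ hlow (n := 2)]
    · refine (pow_le_pow_left₀ (by linarith) hupp 2).trans ?_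
      have hk2 : k ^ 2 ≤ 1 + 31 / 15 * (k - 1) := by nlinarith
      nlinarith [pow_le_pow_left₀ (sq_nonneg k) hk2 2]
  · obtain ⟨h1, h2, h3⟩ := hle h
    rw [abs_of_nonpos (by linarith)]
    have hupp : a * (1 - t) / (1 - a ^ 2 * t) ≤ 1 := by
      rw [div_le_one hden]
      nlinarith [mul_nonneg (sub_nonneg.2 h1) (by positivity : 0 ≤ 1 + a * t)]
    have hlow : k ^ 2 ≤ a * (1 - t) / (1 - a ^ 2 * t) := by
      rw [le_div_iff₀ hden]
      have := affine_nonneg_of_endpoints (p := a - k ^ 2) (q := k ^ 2 * a ^ 2 - a) hb ht htb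
        (by nlinarith) (by linarith)
      linarith
    constructor
    · refine le_trans ?_ (pow_le_pow_left₀ (sq_nonneg k) hlow 2)
      have hk2 : 1 + 2 * (k - 1) ≤ k ^ 2 := by nlinarith [sq_nonneg (k - 1)]
      nlinarith [sq_nonneg (k ^ 2 - 1)]
    · linarith [pow_le_one₀ ((sq_nonneg k).trans hlow) hupp (n := 2)]
end
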